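/- arXiv:1305.6080 — 2 statements merged into one kernel-verified Lean document; each statement's English description precedes it below -/
import Mathlib

section
/- The set of valid 𝓛-formulas is recursively enumerable. -/
/-!
Formalization of the framework of "A machine that knows its own code" (S. Alexander).

The language 𝓛 is the language of Peano arithmetic (constant `0`, unary successor `S`,
binary `+` and `·`) extended by a unary modal operator `K`.
-/

/-- Terms of the language 𝓛 of Peano arithmetic (variables are indexed by `ℕ`). -/
inductive LTerm : Type
  | var : ℕ → LTerm
  | zero : LTerm
  | succ : LTerm → LTerm
  | add : LTerm → LTerm → LTerm
  | mul : LTerm → LTerm → LTerm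
  deriving DecidableEq

/-- Formulas of 𝓛: atomic equalities, falsum, implication, universal quantification,
and the modal operator `K`.  Other connectives and `∃` are defined below. -/
inductive LFormula : Type
  | eq : LTerm → LTerm → LFormula
  | falsum : LFormula
  | imp : LFormula → LFormula → LFormula
  | all : ℕ → LFormula → LFormula
  | K : LFormula → LFormula
  deriving DecidableEq

namespace LTerm

/-- Variables occurring in a term. -/
def fv : LTerm → Finset ℕ
  | var n => {n}
  | zero => ∅
  | succ t => t.fv
  | add t u => t.fv ∪ u.fv
  | mul t u => t.fv ∪ u.fv

/-- Simultaneous substitution of terms for variables in a term. -/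
def subst (s : ℕ → LTerm) : LTerm → LTerm
  | var n => s n
  | zero => zero
  | succ t => succ (t.subst s)
  | add t u => add (t.subst s) (u.subst s)
  | mul t u => mul (t.subst s) (u.subst s)

end LTerm

/-- The numeral `n̄` for a natural number `n`. -/
def numeral : ℕ → LTerm
  | 0 => LTerm.zero
  | n + 1 => LTerm.succ (numeral n)

namespace LFormula

/-- The free variables of a formula (the free variables of `K φ` are those of `φ`). -/
def fv : LFormula → Finset ℕ
  | eq t u => t.fv ∪ u.fv
  | falsum => ∅
  | imp a b => a.fv ∪ b.fv
  | all x a => a.fv.erase x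
  | K a => a.fv

/-- Simultaneous substitution of terms for the *free* variables of a formula
(bound variables are left untouched; the substitution is not capture-avoiding). -/
def subst (s : ℕ → LTerm) : LFormula → LFormula
  | eq t u => eq (t.subst s) (u.subst s)
  | falsum => falsum
  | imp a b => imp (a.subst s) (b.subst s)
  | all x a => all x (a.subst fun z => if z = x then LTerm.var x else s z)
  | K a => K (a.subst s)

end LFormula

/-- `subst1 x t φ` is `φ(x|t)`, the result of substituting the term `t` for the free
occurrences of the variable `x` in `φ`. -/
def subst1 (x : ℕ) (t : LTerm) (φ : LFormula) : LFormula :=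
  φ.subst fun z => if z = x then t else LTerm.var z

/-- `instNum s φ` is `φ^s`: the sentence obtained from `φ` by replacing each free
variable `x` of `φ` by the numeral for `s x`. -/
def instNum (s : ℕ → ℕ) (φ : LFormula) : LFormula :=
  φ.subst fun z => numeral (s z)

/-- `SubstitutableVar y x φ`: the variable `y` is substitutable for the variable `x`
in `φ` (no free occurrence of `x` lies within the scope of a quantifier binding `y`). -/
def SubstitutableVar (y x : ℕ) : LFormula → Prop
  | .eq _ _ => True
  | .falsum => True
  | .imp a b => SubstitutableVar y x a ∧ SubstitutableVar y x b
  | .all z a => x ∉ (LFormula.all z a).fv ∨ (y ≠ z ∧ SubstitutableVar y x a)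
  | .K a => SubstitutableVar y x a

/-- Correspondence of variables relative to a list of pairs of bound variables. -/
def VarCorr : List (ℕ × ℕ) → ℕ → ℕ → Prop
  | [], x, y => x = y
  | (a, b) :: Γ, x, y => (x = a ∧ y = b) ∨ (x ≠ a ∧ y ≠ b ∧ VarCorr Γ x y)

/-- Alpha-correspondence of terms relative to a list of pairs of bound variables. -/
def TermAlpha (Γ : List (ℕ × ℕ)) : LTerm → LTerm → Prop
  | .var x, .var y => VarCorr Γ x y
  | .zero, .zero => True
  | .succ t, .succ u => TermAlpha Γ t u
  | .add t₁ t₂, .add u₁ u₂ => TermAlpha Γ t₁ u₁ ∧ TermAlpha Γ t₂ u₂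
  | .mul t₁ t₂, .mul u₁ u₂ => TermAlpha Γ t₁ u₁ ∧ TermAlpha Γ t₂ u₂
  | _, _ => False

/-- Alpha-correspondence of formulas relative to a list of pairs of bound variables. -/
def FormulaAlpha : List (ℕ × ℕ) → LFormula → LFormula → Prop
  | Γ, .eq t₁ t₂, .eq u₁ u₂ => TermAlpha Γ t₁ u₁ ∧ TermAlpha Γ t₂ u₂
  | _, .falsum, .falsum => True
  | Γ, .imp a₁ a₂, .imp b₁ b₂ => FormulaAlpha Γ a₁ b₁ ∧ FormulaAlpha Γ a₂ b₂
  | Γ, .all x a, .all y b => FormulaAlpha ((x, y) :: Γ) a b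
  | Γ, .K a, .K b => FormulaAlpha Γ a b
  | _, _, _ => False

/-- `ψ` is an alphabetic variant of `φ`: `ψ` is obtained from `φ` by renaming bound
variables so as to respect the binding of the quantifiers. -/
def AlphaVariant (φ ψ : LFormula) : Prop := FormulaAlpha [] φ ψ

/-- Negation, defined from `→` and `⊥`. -/
def notF (φ : LFormula) : LFormula := LFormula.imp φ LFormula.falsum

/-- Conjunction (defined connective). -/
def andF (φ ψ : LFormula) : LFormula := notF (LFormula.imp φ (notF ψ))

/-- Biconditional (defined connective). -/
def iffF (φ ψ : LFormula) : LFormula := andF (LFormula.imp φ ψ) (LFormula.imp ψ φ)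

/-- Existential quantification (defined). -/
def exF (x : ℕ) (φ : LFormula) : LFormula := notF (LFormula.all x (notF φ))

/-- A canonical universal closure of a formula. -/
def uclose (φ : LFormula) : LFormula :=
  (φ.fv.sort (· ≤ ·)).foldr LFormula.all φ

/-- An 𝓛-structure: a first-order structure for the first-order part of 𝓛, together
with a truth assignment `satK s φ` for the purely modal formulas `K φ` at each
assignment `s` into the universe (the three required constraints are singled out
in `IsLStructure` below). -/
structure LStructure where
  U : Type
  nonempty : Nonempty U
  zero : U
  succ : U → U
  add : U → U → U
  mul : U → U → U
  satK : (ℕ → U) → LFormula → Prop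

namespace LStructure

/-- Value of a term under an assignment. -/
def evalT (M : LStructure) (s : ℕ → M.U) : LTerm → M.U
  | .var n => s n
  | .zero => M.zero
  | .succ t => M.succ (M.evalT s t)
  | .add t u => M.add (M.evalT s t) (M.evalT s u)
  | .mul t u => M.mul (M.evalT s t) (M.evalT s u)

/-- Satisfaction `M ⊨ φ[s]`, defined by the usual induction on formula complexity,
with `M ⊨ (K φ)[s]` given by the structure's truth assignment `satK`. -/
def Sat (M : LStructure) : (ℕ → M.U) → LFormula → Prop
  | s, .eq t u => M.evalT s t = M.evalT s u
  | _, .falsum => False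
  | s, .imp a b => M.Sat s a → M.Sat s b
  | s, .all x a => ∀ u : M.U, M.Sat (Function.update s x u) a
  | s, .K a => M.satK s a

/-- `M ⊨ φ`: `M ⊨ φ[s]` for every assignment `s`. -/
def Models (M : LStructure) (φ : LFormula) : Prop := ∀ s : ℕ → M.U, M.Sat s φ

end LStructure

/-- The three constraints making an `LStructure` a genuine 𝓛-structure of the base
logic: (a) `satK s φ` depends only on the values of `s` on the free variables of `φ`;
(b) invariance under alphabetic variants; (c) weak substitution. -/
def IsLStructure (M : LStructure) : Prop :=
  (∀ (φ : LFormula) (s t : ℕ → M.U), (∀ x ∈ φ.fv, s x = t x) →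
      (M.satK s φ ↔ M.satK t φ)) ∧
  (∀ (φ ψ : LFormula) (s : ℕ → M.U), AlphaVariant φ ψ →
      (M.satK s φ ↔ M.satK s ψ)) ∧
  (∀ (φ : LFormula) (x y : ℕ) (s : ℕ → M.U), SubstitutableVar y x φ →
      (M.satK s (subst1 x (LTerm.var y) φ) ↔ M.satK (Function.update s x (s y)) φ))

/-- `Σ ⊨ φ`: every 𝓛-structure satisfying every member of `Σ` satisfies `φ`. -/
def Consequence (T : Set LFormula) (φ : LFormula) : Prop :=
  ∀ M : LStructure, IsLStructure M → (∀ σ ∈ T, M.Models σ) → M.Models φ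

/-- `φ` is valid: `∅ ⊨ φ`, i.e. `φ` holds in every 𝓛-structure under every assignment. -/
def Valid (φ : LFormula) : Prop := Consequence ∅ φ

/-- The structure `M_Σ`: universe `ℕ`, standard interpretations of the symbols of
Peano arithmetic, and `M_Σ ⊨ (K φ)[s]` iff `Σ ⊨ φ^s`. -/
def MSigma (T : Set LFormula) : LStructure where
  U := ℕ
  nonempty := ⟨0⟩
  zero := 0
  succ := Nat.succ
  add := (· + ·)
  mul := (· * ·)
  satK := fun s φ => Consequence T (instNum s φ)

/-- Instances of the schema `E1`: the universal closure of `K φ` for valid `φ`. -/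
def E1set : Set LFormula :=
  {χ | ∃ φ : LFormula, Valid φ ∧ χ = uclose (LFormula.K φ)}

/-- Instances of the schema `E2`: the universal closure of `K(φ → ψ) → K φ → K ψ`. -/
def E2set : Set LFormula :=
  {χ | ∃ φ ψ : LFormula,
    χ = uclose (LFormula.imp (LFormula.K (LFormula.imp φ ψ))
      (LFormula.imp (LFormula.K φ) (LFormula.K ψ)))}

/-- Instances of the schema `E3` (factivity): the universal closure of `K φ → φ`. -/
def E3set : Set LFormula :=
  {χ | ∃ φ : LFormula, χ = uclose (LFormula.imp (LFormula.K φ) φ)}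

/-- Instances of the schema `E4`: the universal closure of `K φ → K K φ`. -/
def E4set : Set LFormula :=
  {χ | ∃ φ : LFormula, χ = uclose (LFormula.imp (LFormula.K φ) (LFormula.K (LFormula.K φ)))}

/-- The axioms of Peano arithmetic for 𝓛: the six usual axioms for successor,
addition and multiplication, and the induction schema extended to all 𝓛-formulas. -/
inductive PAax : LFormula → Prop
  | succ_ne_zero : PAax (.all 0 (notF (.eq (.succ (.var 0)) .zero)))
  | succ_inj : PAax (.all 0 (.all 1 (.imp (.eq (.succ (.var 0)) (.succ (.var 1)))
      (.eq (.var 0) (.var 1)))))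
  | add_zero : PAax (.all 0 (.eq (.add (.var 0) .zero) (.var 0)))
  | add_succ : PAax (.all 0 (.all 1 (.eq (.add (.var 0) (.succ (.var 1)))
      (.succ (.add (.var 0) (.var 1))))))
  | mul_zero : PAax (.all 0 (.eq (.mul (.var 0) .zero) .zero))
  | mul_succ : PAax (.all 0 (.all 1 (.eq (.mul (.var 0) (.succ (.var 1)))
      (.add (.mul (.var 0) (.var 1)) (.var 0)))))
  | ind (φ : LFormula) (x : ℕ) :
      PAax (uclose (.imp (subst1 x .zero φ)
        (.imp (.all x (.imp φ (subst1 x (.succ (.var x)) φ))) (.all x φ))))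

/-- The set of axioms of Peano arithmetic for 𝓛. -/
def PAset : Set LFormula := {φ | PAax φ}

/-- `W e`: the `e`-th recursively enumerable subset of `ℕ` (the domain of the `e`-th
partial computable function). -/
def W (e : ℕ) : Set ℕ :=
  {m | ((Denumerable.ofNat Nat.Partrec.Code e).eval m).Dom}

namespace LTerm

/-- A canonical Gödel numbering of terms. -/
def gnum : LTerm → ℕ
  | var n => Nat.pair 0 n
  | zero => Nat.pair 1 0
  | succ t => Nat.pair 2 t.gnum
  | add t u => Nat.pair 3 (Nat.pair t.gnum u.gnum)
  | mul t u => Nat.pair 4 (Nat.pair t.gnum u.gnum)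

end LTerm

namespace LFormula

/-- A canonical Gödel numbering `⌜φ⌝` of formulas. -/
def gnum : LFormula → ℕ
  | eq t u => Nat.pair 0 (Nat.pair t.gnum u.gnum)
  | falsum => Nat.pair 1 0
  | imp a b => Nat.pair 2 (Nat.pair a.gnum b.gnum)
  | all x a => Nat.pair 3 (Nat.pair x a.gnum)
  | K a => Nat.pair 4 a.gnum

end LFormula

/-- The designated variable `x`. -/
def vx : ℕ := 0
/-- The designated variable `y` (second pairing argument). -/
def vy : ℕ := 1
/-- The designated variable `e` (r.e. index). -/
def ve : ℕ := 2

/-- A formula is `K`-free (purely first-order) if the operator `K` does not occur in it. -/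
def KFree : LFormula → Prop
  | .eq _ _ => True
  | .falsum => True
  | .imp a b => KFree a ∧ KFree b
  | .all _ a => KFree a
  | .K _ => False

/-- The standard structure: universe `ℕ` with the standard interpretations of the
symbols of Peano arithmetic (the modal component is irrelevant for `K`-free formulas). -/
def StdModel : LStructure where
  U := ℕ
  nonempty := ⟨0⟩
  zero := 0
  succ := Nat.succ
  add := (· + ·)
  mul := (· * ·)
  satK := fun _ _ => False

/-- `pwNum pw a b k`: the result of substituting the numerals `ā`, `b̄`, `k̄` for the
designated variables `x`, `y`, `e` in the formula `pw` (read: `⟨ā, b̄⟩ ∈ W_k̄`). -/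
def pwNum (pw : LFormula) (a b k : ℕ) : LFormula :=
  instNum (fun z => if z = vx then a else if z = vy then b else k) pw

/-- `wNum w a k`: the result of substituting the numerals `ā`, `k̄` for the designated
variables `x`, `e` in the formula `w` (read: `ā ∈ W_k̄`). -/
def wNum (w : LFormula) (a k : ℕ) : LFormula :=
  instNum (fun z => if z = vx then a else k) w

/-- Line 3 of the definition of `Σ(n)`: the sentence
`∀x (K φ ↔ ⟨x, ⌜φ⌝⟩ ∈ W_n̄)`, where `pw` is the formula (with designated free
variables `x`, `y`, `e`) expressing `⟨x, y⟩ ∈ W_e`. -/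
def line3 (pw : LFormula) (n : ℕ) (φ : LFormula) : LFormula :=
  LFormula.all vx (iffF (LFormula.K φ)
    (subst1 ve (numeral n) (subst1 vy (numeral φ.gnum) pw)))

/-- Membership in the axiom set `Σ(n)` (relative to the formula `pw` expressing
`⟨x, y⟩ ∈ W_e`): (1) instances of `E1`, `E2`, `E4`; (2) the axioms of Peano
arithmetic for 𝓛; (3) `∀x (K φ ↔ ⟨x, ⌜φ⌝⟩ ∈ W_n̄)` for `φ` with free variables
⊆ {x}; (4) assigned validity `φ^s` for valid `φ`; (5) `K φ` for `φ` an instance of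
lines 1–4 or, recursively, of line 5. -/
inductive SigmaAx (pw : LFormula) (n : ℕ) : LFormula → Prop
  | e1 {χ : LFormula} (h : χ ∈ E1set) : SigmaAx pw n χ
  | e2 {χ : LFormula} (h : χ ∈ E2set) : SigmaAx pw n χ
  | e4 {χ : LFormula} (h : χ ∈ E4set) : SigmaAx pw n χ
  | pa {χ : LFormula} (h : PAax χ) : SigmaAx pw n χ
  | code (φ : LFormula) (h : φ.fv ⊆ {vx}) : SigmaAx pw n (line3 pw n φ)
  | av (φ : LFormula) (s : ℕ → ℕ) (h : Valid φ) : SigmaAx pw n (instNum s φ)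
  | k {φ : LFormula} (h : SigmaAx pw n φ) : SigmaAx pw n (LFormula.K φ)

/-- The axiom set `Σ(n)` (relative to `pw`). -/
def SigmaN (pw : LFormula) (n : ℕ) : Set LFormula := {φ | SigmaAx pw n φ}

/-- The set `{ ⟨m, ⌜φ⌝⟩ : φ an 𝓛-formula with free variables ⊆ {x} and
Σ(n) ⊨ φ(x|m̄) }`. -/
def goalSet (pw : LFormula) (n : ℕ) : Set ℕ :=
  {p | ∃ (m : ℕ) (φ : LFormula), p = Nat.pair m φ.gnum ∧ φ.fv ⊆ {vx} ∧
    Consequence (SigmaN pw n) (subst1 vx (numeral m) φ)}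

attribute [fun_prop] Primrec
attribute [fun_prop] Primrec.id Primrec.const Primrec.comp Primrec.pair

section PrimrecClosure

variable {α β γ : Type*} [Primcodable α] [Primcodable β] [Primcodable γ]

@[fun_prop]
theorem Primrec.fst_apply {f : α → β × γ} (hf : Primrec f) : Primrec fun a => (f a).1 :=
  Primrec.fst.comp hf

@[fun_prop]
theorem Primrec.snd_apply {f : α → β × γ} (hf : Primrec f) : Primrec fun a => (f a).2 :=
  Primrec.snd.comp hf

@[fun_prop]
theorem Primrec.natPair_apply {f g : α → ℕ} (hf : Primrec f) (hg : Primrec g) :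
    Primrec fun a => Nat.pair (f a) (g a) :=
  Primrec₂.natPair.comp hf hg

@[fun_prop]
theorem Primrec.unpair_apply {f : α → ℕ} (hf : Primrec f) : Primrec fun a => (f a).unpair :=
  Primrec.unpair.comp hf

@[fun_prop]
theorem Primrec.add_one_apply {f : α → ℕ} (hf : Primrec f) : Primrec fun a => f a + 1 :=
  Primrec.succ.comp hf

@[fun_prop]
theorem Primrec.list_cons_apply {f : α → β} {g : α → List β} (hf : Primrec f) (hg : Primrec g) :
    Primrec fun a => f a :: g a :=
  Primrec.list_cons.comp hf hg

theorem PrimrecPred.forall_mem {R : α → β → Prop} {f : α → List β}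
    (hR : PrimrecPred fun p : α × β => R p.1 p.2) (hf : Primrec f) :
    PrimrecPred fun a => ∀ b ∈ f a, R a b := by
  have h : PrimrecRel fun b a => R a b := hR.comp (Primrec.pair Primrec.snd Primrec.fst)
  exact PrimrecPred.comp (p := fun p : List β × α => ∀ b ∈ p.1, R p.2 b) h.forall_mem_list
    (hf.pair Primrec.id)

theorem PrimrecPred.exists_mem {R : α → β → Prop} {f : α → List β}
    (hR : PrimrecPred fun p : α × β => R p.1 p.2) (hf : Primrec f) :
    PrimrecPred fun a => ∃ b ∈ f a, R a b := by
  have h : PrimrecRel fun b a => R a b := hR.comp (Primrec.pair Primrec.snd Primrec.fst)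
  exact PrimrecPred.comp (p := fun p : List β × α => ∃ b ∈ p.1, R p.2 b) h.exists_mem_list
    (hf.pair Primrec.id)

theorem PrimrecPred.eq_apply {f g : α → ℕ} (hf : Primrec f) (hg : Primrec g) :
    PrimrecPred fun a => f a = g a :=
  PrimrecPred.comp (p := fun p : ℕ × ℕ => p.1 = p.2) Primrec.eq (hf.pair hg)

theorem PrimrecPred.mem_list {f : α → ℕ} {l : α → List ℕ} (hf : Primrec f) (hl : Primrec l) :
    PrimrecPred fun a => f a ∈ l a := by
  have h : PrimrecPred fun a => ∃ b ∈ l a, b = f a :=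
    PrimrecPred.exists_mem (R := fun a b => b = f a)
      (PrimrecPred.eq_apply (by fun_prop) (by fun_prop)) hl
  exact h.of_eq fun a => by simp

/-- An existential quantifier over `ℕ` in front of a primitive recursive relation yields a
recursively enumerable predicate. -/
theorem PrimrecPred.rePred_exists {R : α → ℕ → Prop}
    (hR : PrimrecPred fun p : α × ℕ => R p.1 p.2) : REPred fun a => ∃ n, R a n := by
  obtain ⟨hdec, hd⟩ := hR
  have (a : α) (n : ℕ) : Decidable (R a n) := hdec (a, n)
  have hd : Primrec fun p : α × ℕ => decide (R p.1 p.2) := hd.of_eq fun p => by congr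
  have hp : Partrec₂ fun (a : α) (n : ℕ) => (Part.some (decide (R a n)) : Part Bool) :=
    hd.to_comp.partrec
  refine (Partrec.dom_re (Partrec.rfind hp)).of_eq fun a => ?_
  exact Nat.rfind_dom'.trans (by simp)

end PrimrecClosure

/-- A clause `(B, H)` holds under a valuation `V` if some atom of `H` is true as soon as all atoms
of `B` are. -/
def ClauseHolds (V : ℕ → Prop) (c : List ℕ × List ℕ) : Prop :=
  (∀ a ∈ c.1, V a) → ∃ b ∈ c.2, V b

/-- A parametrized condition on valuations is clausal if it is expressed, uniformly in the
parameter, by a primitive recursive sequence of clauses. -/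
def Clausal {α : Type*} [Primcodable α] (P : α → (ℕ → Prop) → Prop) : Prop :=
  ∃ f : α × ℕ → List ℕ × List ℕ, Primrec f ∧ ∀ a V, P a V ↔ ∀ n, ClauseHolds V (f (a, n))

namespace Clausal

variable {α : Type*} [Primcodable α] {P Q : α → (ℕ → Prop) → Prop}

theorem false : Clausal fun (_ : α) _ => False :=
  ⟨fun _ => ([], []), by fun_prop, fun a V => by simp [ClauseHolds]⟩

theorem atom {f : α → ℕ} (hf : Primrec f) : Clausal fun a V => V (f a) :=
  ⟨fun p => ([], [f p.1]), by fun_prop, fun a V => by simp [ClauseHolds]⟩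

theorem imp {f : α → ℕ} (hf : Primrec f) (hP : Clausal P) :
    Clausal fun a V => V (f a) → P a V := by
  obtain ⟨g, hg, h⟩ := hP
  refine ⟨fun p => (f p.1 :: (g p).1, (g p).2), by fun_prop, fun a V => ?_⟩
  simp only [h, ClauseHolds, List.forall_mem_cons, and_imp]
  exact ⟨fun H n ha => H ha n, fun H ha n => H n ha⟩

theorem or {f : α → ℕ} (hf : Primrec f) (hP : Clausal P) :
    Clausal fun a V => V (f a) ∨ P a V := by
  obtain ⟨g, hg, h⟩ := hP
  refine ⟨fun p => ((g p).1, f p.1 :: (g p).2), by fun_prop, fun a V => ?_⟩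
  simp only [h, ClauseHolds, List.exists_mem_cons_iff]
  by_cases hf : V (f a) <;> simp [hf]

theorem and (hP : Clausal P) (hQ : Clausal Q) : Clausal fun a V => P a V ∧ Q a V := by
  obtain ⟨f, hf, h⟩ := hP
  obtain ⟨g, hg, h'⟩ := hQ
  refine ⟨fun p => bif p.2.bodd then f (p.1, p.2.div2) else g (p.1, p.2.div2), ?_, fun a V => ?_⟩
  · have hdiv : Primrec fun p : α × ℕ => (p.1, p.2.div2) :=
      Primrec.fst.pair (Primrec.nat_div2.comp Primrec.snd)
    exact Primrec.cond (Primrec.nat_bodd.comp Primrec.snd) (hf.comp hdiv) (hg.comp hdiv)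
  · simp only [h, h']
    constructor
    · rintro ⟨h₁, h₂⟩ n
      cases n.bodd <;> simp [h₁, h₂]
    · intro H
      refine ⟨fun n => ?_, fun n => ?_⟩
      · simpa using H (Nat.bit Bool.true n)
      · simpa using H (Nat.bit Bool.false n)

theorem all {P : α → ℕ → (ℕ → Prop) → Prop} (hP : Clausal fun (p : α × ℕ) V => P p.1 p.2 V) :
    Clausal fun a V => ∀ x, P a x V := by
  obtain ⟨f, hf, h⟩ := hP
  refine ⟨fun p => f ((p.1, p.2.unpair.1), p.2.unpair.2), by fun_prop, fun a V => ?_⟩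
  refine (forall_congr' fun x => h (a, x) V).trans ⟨fun H n => H _ _, fun H x n => ?_⟩
  simpa using H (Nat.pair x n)

theorem ne_imp {f g : α → ℕ} (hf : Primrec f) (hg : Primrec g) (hP : Clausal P) :
    Clausal fun a V => f a ≠ g a → P a V := by
  obtain ⟨u, hu, h⟩ := hP
  refine ⟨fun p => if f p.1 = g p.1 then ([0], [0]) else u p, ?_, fun a V => ?_⟩
  · exact Primrec.ite (PrimrecPred.eq_apply (by fun_prop) (by fun_prop)) (by fun_prop) hu
  · by_cases hfg : f a = g a <;> simp [hfg, h, ClauseHolds]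

/-- Lists representing all sets of natural numbers below a bound. -/
def subsetLists : ℕ → List (List ℕ)
  | 0 => [[]]
  | n + 1 => (subsetLists n).flatMap fun l => [l, n :: l]

theorem primrec_subsetLists : Primrec subsetLists := by
  have hstep : Primrec₂ fun (n : ℕ) (l : List ℕ) => [l, n :: l] := by
    unfold Primrec₂; fun_prop
  have hflat : Primrec₂ fun (_ : ℕ) (p : ℕ × List (List ℕ)) =>
      p.2.flatMap fun l => [l, p.1 :: l] :=
    Primrec.list_flatMap (Primrec.snd.comp Primrec.snd)
      (hstep.comp (Primrec.fst.comp (Primrec.snd.comp Primrec.fst)) Primrec.snd)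
  refine (Primrec.nat_rec' Primrec.id (Primrec.const [[]]) hflat).of_eq fun n => ?_
  induction n with
  | zero => rfl
  | succ n ih => simp only [id, subsetLists] at ih ⊢; rw [← ih]

theorem exists_mem_subsetLists (V : ℕ → Prop) (n : ℕ) :
    ∃ l ∈ subsetLists n, ∀ x, x ∈ l ↔ x < n ∧ V x := by
  induction n with
  | zero => exact ⟨[], by simp [subsetLists], by simp⟩
  | succ n ih =>
    obtain ⟨l, hl, h⟩ := ih
    by_cases hn : V n
    · refine ⟨n :: l, List.mem_flatMap.2 ⟨l, hl, by simp⟩, fun x => ?_⟩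
      rw [List.mem_cons, h]
      grind
    · refine ⟨l, List.mem_flatMap.2 ⟨l, hl, by simp⟩, fun x => ?_⟩
      rw [h]
      grind

/-- Every valuation falsifies one of the first `N` clauses of `c` using only atoms below `N`. -/
def Refuted (c : ℕ → List ℕ × List ℕ) (N : ℕ) : Prop :=
  ∀ l ∈ subsetLists N, ∃ i ∈ List.range N,
    (∀ a ∈ (c i).1, a ∈ l) ∧ ∀ b ∈ (c i).2, b ∉ l ∧ b ∈ List.range N

theorem primrecPred_refuted {c : α × ℕ → List ℕ × List ℕ} (hc : Primrec c) :
    PrimrecPred fun p : α × ℕ => Refuted (fun i => c (p.1, i)) p.2 := by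
  have hrange : Primrec List.range := Primrec.list_range
  have hsub := primrec_subsetLists
  refine PrimrecPred.forall_mem (R := fun (p : α × ℕ) l => ∃ i ∈ List.range p.2,
    (∀ a ∈ (c (p.1, i)).1, a ∈ l) ∧ ∀ b ∈ (c (p.1, i)).2, b ∉ l ∧ b ∈ List.range p.2)
    ?_ (by fun_prop)
  refine PrimrecPred.exists_mem (R := fun (q : (α × ℕ) × List ℕ) i =>
    (∀ a ∈ (c (q.1.1, i)).1, a ∈ q.2) ∧
      ∀ b ∈ (c (q.1.1, i)).2, b ∉ q.2 ∧ b ∈ List.range q.1.2) ?_ (by fun_prop)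
  refine PrimrecPred.and ?_ ?_
  · exact PrimrecPred.forall_mem (R := fun (q : ((α × ℕ) × List ℕ) × ℕ) a => a ∈ q.1.2)
      (PrimrecPred.mem_list (by fun_prop) (by fun_prop)) (by fun_prop)
  · exact PrimrecPred.forall_mem
      (R := fun (q : ((α × ℕ) × List ℕ) × ℕ) b => b ∉ q.1.2 ∧ b ∈ List.range q.1.1.2)
      ((PrimrecPred.mem_list (by fun_prop) (by fun_prop)).not.and
        (PrimrecPred.mem_list (by fun_prop) (by fun_prop))) (by fun_prop)

/-- Compactness: a sequence of clauses is unsatisfiable iff it is refuted at a finite stage. -/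
theorem exists_refuted_iff (c : ℕ → List ℕ × List ℕ) :
    (∃ N, Refuted c N) ↔ ∀ V : ℕ → Prop, ¬ ∀ n, ClauseHolds V (c n) := by
  constructor
  · rintro ⟨N, hN⟩ V hV
    obtain ⟨l, hl, h⟩ := exists_mem_subsetLists V N
    obtain ⟨i, -, hB, hH⟩ := hN l hl
    obtain ⟨b, hb, hVb⟩ := hV i fun a ha => ((h a).1 (hB a ha)).2
    exact (hH b hb).1 ((h b).2 ⟨List.mem_range.1 (hH b hb).2, hVb⟩)
  · contrapose!
    intro hN
    let S : ℕ → Set (ℕ → Bool) := fun i => {V | ClauseHolds (fun a => V a = true) (c i)}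
    have hS : ∀ i, IsClosed (S i) := by
      intro i
      have hatom : ∀ a : ℕ, IsClopen {V : ℕ → Bool | V a = true} := fun a =>
        (isClopen_discrete {true}).preimage (continuous_apply a)
      have : S i = (⋂ a ∈ (c i).1.toFinset, {V : ℕ → Bool | V a = true})ᶜ ∪
          ⋃ b ∈ (c i).2.toFinset, {V : ℕ → Bool | V b = true} := by
        ext V
        simp only [S, ClauseHolds, Set.mem_ofPred_eq, Set.mem_union, Set.mem_compl_iff,
          Set.mem_iInter, Set.mem_iUnion, List.mem_toFinset, exists_prop, imp_iff_not_or]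
      rw [this]
      exact ((Set.Finite.isClopen_biInter (Finset.finite_toSet _) fun a _ => hatom a).compl.union
        (Set.Finite.isClopen_biUnion (Finset.finite_toSet _) fun b _ => hatom b)).isClosed
    obtain ⟨V, hV⟩ : (⋂ n, ⋂ i ≤ n, S i).Nonempty := by
      refine IsCompact.nonempty_iInter_of_sequence_nonempty_isCompact_isClosed _ ?_ ?_
        (IsClosed.isCompact ?_) ?_
      · exact fun n => Set.biInter_subset_biInter_left fun i hi => Nat.le_succ_of_le hi
      · intro n
        obtain ⟨N, hnN, hbound⟩ : ∃ N, n < N ∧ ∀ i ≤ n, ∀ b ∈ (c i).2, b < N := by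
          refine ⟨n + 1 + ∑ i ∈ Finset.range (n + 1), (c i).2.sum, by omega,
            fun i hi b hb => ?_⟩
          have h₁ := List.single_le_sum (fun _ _ => Nat.zero_le _) b hb
          have h₂ := Finset.single_le_sum (f := fun i => (c i).2.sum)
            (fun _ _ => Nat.zero_le _) (Finset.mem_range.2 (show i < n + 1 by omega))
          omega
        have h := hN N
        simp only [Refuted, not_forall, not_exists, not_and] at h
        obtain ⟨l, -, h⟩ := h
        refine ⟨fun a => decide (a ∈ l), Set.mem_iInter₂.2 fun i hi hB => ?_⟩
        obtain ⟨b, hb, hbl⟩ := h i (List.mem_range.2 (hi.trans_lt hnN)) (by simpa using hB)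
        refine ⟨b, hb, ?_⟩
        by_contra hbl'
        exact hbl (by simpa using hbl') (List.mem_range.2 (hbound i hi b hb))
      · exact isClosed_biInter fun i _ => hS i
      · exact fun n => isClosed_biInter fun i _ => hS i
    exact ⟨fun a => V a = true, fun n => Set.mem_iInter₂.1 (Set.mem_iInter.1 hV n) n le_rfl⟩

/-- Unsatisfiability of a clausal condition is recursively enumerable in the parameter. -/
theorem rePred_unsat (hP : Clausal P) : REPred fun a => ∀ V, ¬ P a V := by
  obtain ⟨c, hc, h⟩ := hP
  refine (PrimrecPred.rePred_exists (R := fun a N => Refuted (fun i => c (a, i)) N)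
    (primrecPred_refuted hc)).of_eq fun a => ?_
  simp only [exists_refuted_iff, h]

end Clausal

theorem REPred.exists_W {p : ℕ → Prop} (hp : REPred p) : ∃ e, W e = {k | p k} := by
  have h : Partrec fun k => (Part.assert (p k) fun _ => Part.some ()).map fun _ => 0 :=
    Partrec.map hp (Computable.const 0).to₂
  obtain ⟨c, hc⟩ := Nat.Partrec.Code.exists_code.1 (Partrec.nat_iff.1 h)
  refine ⟨Encodable.encode c, Set.ext fun k => ?_⟩
  simp [W, hc, Part.assert]

open Nat (pair)

/-- The code of the environment (or list of pairs) obtained by prepending `(x, n)` to `e`. -/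
def consCode (x n e : ℕ) : ℕ := pair x (pair n e) + 1

/-- The relations on codes used to axiomatize satisfaction. Names of elements are natural numbers,
and an environment is a code of a list of pairs of a variable and a name. -/
structure SatRel where
  /-- `look e x n`: the environment `e` maps `x` to `n`. -/
  look : ℕ → ℕ → ℕ → Prop
  /-- `val t e n`: the term `t` has the value `n` in `e`. -/
  val : ℕ → ℕ → ℕ → Prop
  /-- `eq n m`: the names `n` and `m` denote the same element. -/
  eq : ℕ → ℕ → Prop
  /-- `tr φ e`: the formula `φ` holds in `e`. -/
  tr : ℕ → ℕ → Prop
  /-- `nfT x t`: the variable `x` does not occur in the term `t`. -/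
  nfT : ℕ → ℕ → Prop
  /-- `nf x φ`: the variable `x` is not free in the formula `φ`. -/
  nf : ℕ → ℕ → Prop
  /-- `sbT x y t u`: the term `u` is `t(x|y)`. -/
  sbT : ℕ → ℕ → ℕ → ℕ → Prop
  /-- `sb x y φ ψ`: `y` is substitutable for `x` in `φ`, and `ψ` is `φ(x|y)`. -/
  sb : ℕ → ℕ → ℕ → ℕ → Prop
  /-- `vc Γ x y`: correspondence of variables relative to `Γ`. -/
  vc : ℕ → ℕ → ℕ → Prop
  /-- `alT Γ t u`: alpha-correspondence of terms relative to `Γ`. -/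
  alT : ℕ → ℕ → ℕ → Prop
  /-- `al Γ φ ψ`: alpha-correspondence of formulas relative to `Γ`. -/
  al : ℕ → ℕ → ℕ → Prop
  /-- `agT t e e'`: `e` and `e'` agree on the variables of the term `t`. -/
  agT : ℕ → ℕ → ℕ → Prop
  /-- `ag φ e e'`: `e` and `e'` agree on the free variables of the formula `φ`. -/
  ag : ℕ → ℕ → ℕ → Prop
  /-- `tm t`: `t` is the code of a term. -/
  tm : ℕ → Prop
  /-- `fm φ`: `φ` is the code of a formula. -/
  fm : ℕ → Prop

namespace SatRel

/-- The code of an atom with tag `k`. -/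
def atomCode (k a b c d : ℕ) : ℕ := pair k (pair a (pair b (pair c d)))

/-- The relations described by a valuation of the atoms. -/
def ofVal (V : ℕ → Prop) : SatRel where
  look e x n := V (atomCode 0 e x n 0)
  val t e n := V (atomCode 1 t e n 0)
  eq n m := V (atomCode 2 n m 0 0)
  tr φ e := V (atomCode 3 φ e 0 0)
  nfT x t := V (atomCode 4 x t 0 0)
  nf x φ := V (atomCode 5 x φ 0 0)
  sbT x y t u := V (atomCode 6 x y t u)
  sb x y φ ψ := V (atomCode 7 x y φ ψ)
  vc Γ x y := V (atomCode 8 Γ x y 0)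
  alT Γ t u := V (atomCode 9 Γ t u 0)
  al Γ φ ψ := V (atomCode 10 Γ φ ψ 0)
  agT t e e' := V (atomCode 11 t e e' 0)
  ag φ e e' := V (atomCode 12 φ e e' 0)
  tm t := V (atomCode 13 t 0 0 0)
  fm φ := V (atomCode 14 φ 0 0 0)

theorem exists_ofVal (D : SatRel) : ∃ V, ofVal V = D := by
  let F : ℕ → ℕ → ℕ → ℕ → ℕ → Prop := fun k a b c d =>
    match k with
    | 0 => D.look a b c
    | 1 => D.val a b c
    | 2 => D.eq a b
    | 3 => D.tr a b
    | 4 => D.nfT a b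
    | 5 => D.nf a b
    | 6 => D.sbT a b c d
    | 7 => D.sb a b c d
    | 8 => D.vc a b c
    | 9 => D.alT a b c
    | 10 => D.al a b c
    | 11 => D.agT a b c
    | 12 => D.ag a b c
    | 13 => D.tm a
    | _ => D.fm a
  refine ⟨fun n => F n.unpair.1 n.unpair.2.unpair.1 n.unpair.2.unpair.2.unpair.1
    n.unpair.2.unpair.2.unpair.2.unpair.1 n.unpair.2.unpair.2.unpair.2.unpair.2, ?_⟩
  simp [ofVal, atomCode, F]

variable (D : SatRel)

def LookupRules : Prop :=
  (∀ x, D.look 0 x (pair 0 x)) ∧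
  (∀ x n e, D.look (consCode x n e) x n) ∧
  (∀ x y n m e, x ≠ y → D.look e x m → D.look (consCode y n e) x m)

def ValRules : Prop :=
  (∀ x e n, D.look e x n → D.val (pair 0 x) e n) ∧
  (∀ e, D.val (pair 1 0) e (pair 1 0)) ∧
  (∀ t e n, D.val t e n → D.val (pair 2 t) e (pair 2 n)) ∧
  (∀ t u e n m, D.val t e n → D.val u e m → D.val (pair 3 (pair t u)) e (pair 3 (pair n m))) ∧
  (∀ t u e n m, D.val t e n → D.val u e m → D.val (pair 4 (pair t u)) e (pair 4 (pair n m)))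

def EqRules : Prop :=
  (∀ n, D.eq n n) ∧
  (∀ n m, D.eq n m → D.eq m n) ∧
  (∀ n m k, D.eq n m → D.eq m k → D.eq n k) ∧
  (∀ n m, D.eq n m → D.eq (pair 2 n) (pair 2 m)) ∧
  (∀ n m k l, D.eq n m → D.eq k l → D.eq (pair 3 (pair n k)) (pair 3 (pair m l))) ∧
  (∀ n m k l, D.eq n m → D.eq k l → D.eq (pair 4 (pair n k)) (pair 4 (pair m l)))

/-- The defining clauses of satisfaction for the first-order part; `pair 5 (pair (pair x a) e)` names
an element falsifying `a` in place of `x`, if there is any. -/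
def TruthRules : Prop :=
  (∀ t u e n m, D.val t e n → D.val u e m → D.tr (pair 0 (pair t u)) e → D.eq n m) ∧
  (∀ t u e n m, D.val t e n → D.val u e m → D.eq n m → D.tr (pair 0 (pair t u)) e) ∧
  (∀ e, D.tr (pair 1 0) e → False) ∧
  (∀ a b e, D.tr (pair 2 (pair a b)) e → D.tr a e → D.tr b e) ∧
  (∀ a b e, D.tr a e ∨ D.tr (pair 2 (pair a b)) e) ∧
  (∀ a b e, D.tr b e → D.tr (pair 2 (pair a b)) e) ∧
  (∀ x a e n, D.tr (pair 3 (pair x a)) e → D.tr a (consCode x n e)) ∧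
  (∀ x a e, D.tr a (consCode x (pair 5 (pair (pair x a) e)) e) → D.tr (pair 3 (pair x a)) e)

/-- The three constraints on purely modal formulas. -/
def ModalRules : Prop :=
  (∀ φ e e', D.ag φ e e' → D.tr (pair 4 φ) e → D.tr (pair 4 φ) e') ∧
  (∀ φ ψ e, D.al 0 φ ψ → D.tr (pair 4 φ) e → D.tr (pair 4 ψ) e) ∧
  (∀ φ ψ e, D.al 0 φ ψ → D.tr (pair 4 ψ) e → D.tr (pair 4 φ) e) ∧
  (∀ φ ψ x y n e, D.sb x y φ ψ → D.look e y n → D.tr (pair 4 ψ) e →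
    D.tr (pair 4 φ) (consCode x n e)) ∧
  (∀ φ ψ x y n e, D.sb x y φ ψ → D.look e y n → D.tr (pair 4 φ) (consCode x n e) →
    D.tr (pair 4 ψ) e)

def NotFreeRules : Prop :=
  (∀ x y, x ≠ y → D.nfT x (pair 0 y)) ∧
  (∀ x, D.nfT x (pair 1 0)) ∧
  (∀ x t, D.nfT x t → D.nfT x (pair 2 t)) ∧
  (∀ x t u, D.nfT x t → D.nfT x u → D.nfT x (pair 3 (pair t u))) ∧
  (∀ x t u, D.nfT x t → D.nfT x u → D.nfT x (pair 4 (pair t u))) ∧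
  (∀ x t u, D.nfT x t → D.nfT x u → D.nf x (pair 0 (pair t u))) ∧
  (∀ x, D.nf x (pair 1 0)) ∧
  (∀ x a b, D.nf x a → D.nf x b → D.nf x (pair 2 (pair a b))) ∧
  (∀ x a, D.nf x (pair 3 (pair x a))) ∧
  (∀ x y a, D.nf x a → D.nf x (pair 3 (pair y a))) ∧
  (∀ x a, D.nf x a → D.nf x (pair 4 a))

def SubstRules : Prop :=
  (∀ x y, D.sbT x y (pair 0 x) (pair 0 y)) ∧
  (∀ x y z, z ≠ x → D.sbT x y (pair 0 z) (pair 0 z)) ∧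
  (∀ x y, D.sbT x y (pair 1 0) (pair 1 0)) ∧
  (∀ x y t t', D.sbT x y t t' → D.sbT x y (pair 2 t) (pair 2 t')) ∧
  (∀ x y t t' u u', D.sbT x y t t' → D.sbT x y u u' →
    D.sbT x y (pair 3 (pair t u)) (pair 3 (pair t' u'))) ∧
  (∀ x y t t' u u', D.sbT x y t t' → D.sbT x y u u' →
    D.sbT x y (pair 4 (pair t u)) (pair 4 (pair t' u'))) ∧
  (∀ x y t t' u u', D.sbT x y t t' → D.sbT x y u u' →
    D.sb x y (pair 0 (pair t u)) (pair 0 (pair t' u'))) ∧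
  (∀ x y, D.sb x y (pair 1 0) (pair 1 0)) ∧
  (∀ x y a a' b b', D.sb x y a a' → D.sb x y b b' →
    D.sb x y (pair 2 (pair a b)) (pair 2 (pair a' b'))) ∧
  (∀ x y z a, D.nf x (pair 3 (pair z a)) → D.sb x y (pair 3 (pair z a)) (pair 3 (pair z a))) ∧
  (∀ x y z a a', x ≠ z → y ≠ z → D.sb x y a a' →
    D.sb x y (pair 3 (pair z a)) (pair 3 (pair z a'))) ∧
  (∀ x y a a', D.sb x y a a' → D.sb x y (pair 4 a) (pair 4 a'))

def AlphaRules : Prop :=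
  (∀ x, D.vc 0 x x) ∧
  (∀ x y Γ, D.vc (consCode x y Γ) x y) ∧
  (∀ a b x y Γ, x ≠ a → y ≠ b → D.vc Γ x y → D.vc (consCode a b Γ) x y) ∧
  (∀ Γ x y, D.vc Γ x y → D.alT Γ (pair 0 x) (pair 0 y)) ∧
  (∀ Γ, D.alT Γ (pair 1 0) (pair 1 0)) ∧
  (∀ Γ t t', D.alT Γ t t' → D.alT Γ (pair 2 t) (pair 2 t')) ∧
  (∀ Γ t t' u u', D.alT Γ t t' → D.alT Γ u u' →
    D.alT Γ (pair 3 (pair t u)) (pair 3 (pair t' u'))) ∧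
  (∀ Γ t t' u u', D.alT Γ t t' → D.alT Γ u u' →
    D.alT Γ (pair 4 (pair t u)) (pair 4 (pair t' u'))) ∧
  (∀ Γ t t' u u', D.alT Γ t t' → D.alT Γ u u' →
    D.al Γ (pair 0 (pair t u)) (pair 0 (pair t' u'))) ∧
  (∀ Γ, D.al Γ (pair 1 0) (pair 1 0)) ∧
  (∀ Γ a a' b b', D.al Γ a a' → D.al Γ b b' →
    D.al Γ (pair 2 (pair a b)) (pair 2 (pair a' b'))) ∧
  (∀ Γ x y a a', D.al (consCode x y Γ) a a' → D.al Γ (pair 3 (pair x a)) (pair 3 (pair y a'))) ∧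
  (∀ Γ a a', D.al Γ a a' → D.al Γ (pair 4 a) (pair 4 a'))

def AgreeRules : Prop :=
  (∀ x e e' n m, D.look e x n → D.look e' x m → D.eq n m → D.agT (pair 0 x) e e') ∧
  (∀ e e', D.agT (pair 1 0) e e') ∧
  (∀ t e e', D.agT t e e' → D.agT (pair 2 t) e e') ∧
  (∀ t u e e', D.agT t e e' → D.agT u e e' → D.agT (pair 3 (pair t u)) e e') ∧
  (∀ t u e e', D.agT t e e' → D.agT u e e' → D.agT (pair 4 (pair t u)) e e') ∧
  (∀ t u e e', D.agT t e e' → D.agT u e e' → D.ag (pair 0 (pair t u)) e e') ∧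
  (∀ e e', D.ag (pair 1 0) e e') ∧
  (∀ a b e e', D.ag a e e' → D.ag b e e' → D.ag (pair 2 (pair a b)) e e') ∧
  (∀ x a e e', D.ag a (consCode x 0 e) (consCode x 0 e') → D.ag (pair 3 (pair x a)) e e') ∧
  (∀ a e e', D.ag a e e' → D.ag (pair 4 a) e e')

def CodeRules : Prop :=
  (∀ x, D.tm (pair 0 x)) ∧
  D.tm (pair 1 0) ∧
  (∀ t, D.tm t → D.tm (pair 2 t)) ∧
  (∀ t u, D.tm t → D.tm u → D.tm (pair 3 (pair t u))) ∧
  (∀ t u, D.tm t → D.tm u → D.tm (pair 4 (pair t u))) ∧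
  (∀ t u, D.tm t → D.tm u → D.fm (pair 0 (pair t u))) ∧
  D.fm (pair 1 0) ∧
  (∀ a b, D.fm a → D.fm b → D.fm (pair 2 (pair a b))) ∧
  (∀ x a, D.fm a → D.fm (pair 3 (pair x a))) ∧
  (∀ a, D.fm a → D.fm (pair 4 a))

/-- The clauses describing counterexamples to the formula with code `k`. -/
structure Refutes (k : ℕ) : Prop where
  look : D.LookupRules
  val : D.ValRules
  eq : D.EqRules
  truth : D.TruthRules
  modal : D.ModalRules
  notFree : D.NotFreeRules
  subst : D.SubstRules
  alpha : D.AlphaRules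
  agree : D.AgreeRules
  code : D.CodeRules
  goal : D.fm k → D.tr k 0 → False

@[fun_prop]
theorem primrec_atomCode {α : Type*} [Primcodable α] {f₀ f₁ f₂ f₃ f₄ : α → ℕ} (h₀ : Primrec f₀)
    (h₁ : Primrec f₁) (h₂ : Primrec f₂) (h₃ : Primrec f₃) (h₄ : Primrec f₄) :
    Primrec fun a => atomCode (f₀ a) (f₁ a) (f₂ a) (f₃ a) (f₄ a) := by
  unfold atomCode; fun_prop

@[fun_prop]
theorem primrec_consCode {α : Type*} [Primcodable α] {f₁ f₂ f₃ : α → ℕ}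
    (h₁ : Primrec f₁) (h₂ : Primrec f₂) (h₃ : Primrec f₃) :
    Primrec fun a => consCode (f₁ a) (f₂ a) (f₃ a) := by
  unfold consCode; fun_prop

theorem clausal_refutes : Clausal fun k V => (ofVal V).Refutes k := by
  have h : Clausal fun k V => (ofVal V).LookupRules ∧ (ofVal V).ValRules ∧ (ofVal V).EqRules ∧
      (ofVal V).TruthRules ∧ (ofVal V).ModalRules ∧ (ofVal V).NotFreeRules ∧
      (ofVal V).SubstRules ∧ (ofVal V).AlphaRules ∧ (ofVal V).AgreeRules ∧ (ofVal V).CodeRules ∧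
      ((ofVal V).fm k → (ofVal V).tr k 0 → False) := by
    simp only [LookupRules, ValRules, EqRules, TruthRules, ModalRules, NotFreeRules, SubstRules,
      AlphaRules, AgreeRules, CodeRules, ofVal]
    repeat' first
      | refine Clausal.and ?_ ?_
      | refine Clausal.all ?_
      | refine Clausal.imp (by fun_prop) ?_
      | refine Clausal.ne_imp (by fun_prop) (by fun_prop) ?_
      | refine Clausal.or (by fun_prop) ?_
      | exact Clausal.atom (by fun_prop)
      | exact Clausal.false
  obtain ⟨f, hf, h⟩ := h
  refine ⟨f, hf, fun k V => (Iff.intro ?_ ?_).trans (h k V)⟩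
  · rintro ⟨h₁, h₂, h₃, h₄, h₅, h₆, h₇, h₈, h₉, h₁₀, h₁₁⟩
    exact ⟨h₁, h₂, h₃, h₄, h₅, h₆, h₇, h₈, h₉, h₁₀, h₁₁⟩
  · rintro ⟨h₁, h₂, h₃, h₄, h₅, h₆, h₇, h₈, h₉, h₁₀, h₁₁⟩
    exact ⟨h₁, h₂, h₃, h₄, h₅, h₆, h₇, h₈, h₉, h₁₀, h₁₁⟩

end SatRel

theorem Nat.unpair_snd_lt {n : ℕ} (h : n.unpair.1 ≠ 0) : n.unpair.2 < n := by
  have := Nat.add_le_pair n.unpair.1 n.unpair.2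
  rw [Nat.pair_unpair] at this
  omega

theorem Nat.unpair_snd_fst_lt {n : ℕ} (h : n.unpair.1 ≠ 0) : n.unpair.2.unpair.1 < n :=
  (Nat.unpair_left_le _).trans_lt (Nat.unpair_snd_lt h)

theorem Nat.unpair_snd_snd_lt {n : ℕ} (h : n.unpair.1 ≠ 0) : n.unpair.2.unpair.2 < n :=
  (Nat.unpair_right_le _).trans_lt (Nat.unpair_snd_lt h)

/-- The term with a given code; junk codes yield `0`. -/
def decodeTerm (n : ℕ) : LTerm :=
  if n.unpair.1 = 0 then .var n.unpair.2
  else if n.unpair.1 = 2 then .succ (decodeTerm n.unpair.2)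
  else if n.unpair.1 = 3 then
    .add (decodeTerm n.unpair.2.unpair.1) (decodeTerm n.unpair.2.unpair.2)
  else if n.unpair.1 = 4 then
    .mul (decodeTerm n.unpair.2.unpair.1) (decodeTerm n.unpair.2.unpair.2)
  else .zero
termination_by n
decreasing_by
  all_goals first
    | exact Nat.unpair_snd_lt ‹_›
    | exact Nat.unpair_snd_fst_lt ‹_›
    | exact Nat.unpair_snd_snd_lt ‹_›

@[simp] theorem decodeTerm_var (x : ℕ) : decodeTerm (pair 0 x) = .var x := by
  rw [decodeTerm]; simp

@[simp] theorem decodeTerm_zero : decodeTerm (pair 1 0) = .zero := by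
  rw [decodeTerm]; simp

@[simp] theorem decodeTerm_succ (t : ℕ) : decodeTerm (pair 2 t) = .succ (decodeTerm t) := by
  rw [decodeTerm]; simp

@[simp] theorem decodeTerm_add (t u : ℕ) :
    decodeTerm (pair 3 (pair t u)) = .add (decodeTerm t) (decodeTerm u) := by
  rw [decodeTerm]; simp

@[simp] theorem decodeTerm_mul (t u : ℕ) :
    decodeTerm (pair 4 (pair t u)) = .mul (decodeTerm t) (decodeTerm u) := by
  rw [decodeTerm]; simp

theorem decodeTerm_gnum (t : LTerm) : decodeTerm t.gnum = t := by
  induction t <;> simp_all [LTerm.gnum]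

/-- The formula with a given code; junk codes yield `⊥`. -/
def decodeFormula (n : ℕ) : LFormula :=
  if n.unpair.1 = 0 then
    .eq (decodeTerm n.unpair.2.unpair.1) (decodeTerm n.unpair.2.unpair.2)
  else if n.unpair.1 = 2 then
    .imp (decodeFormula n.unpair.2.unpair.1) (decodeFormula n.unpair.2.unpair.2)
  else if n.unpair.1 = 3 then .all n.unpair.2.unpair.1 (decodeFormula n.unpair.2.unpair.2)
  else if n.unpair.1 = 4 then .K (decodeFormula n.unpair.2)
  else .falsum
termination_by n
decreasing_by
  all_goals first
    | exact Nat.unpair_snd_lt ‹_›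
    | exact Nat.unpair_snd_fst_lt ‹_›
    | exact Nat.unpair_snd_snd_lt ‹_›

@[simp] theorem decodeFormula_eq (t u : ℕ) :
    decodeFormula (pair 0 (pair t u)) = .eq (decodeTerm t) (decodeTerm u) := by
  rw [decodeFormula]; simp

@[simp] theorem decodeFormula_falsum : decodeFormula (pair 1 0) = .falsum := by
  rw [decodeFormula]; simp

@[simp] theorem decodeFormula_imp (a b : ℕ) :
    decodeFormula (pair 2 (pair a b)) = .imp (decodeFormula a) (decodeFormula b) := by
  rw [decodeFormula]; simp

@[simp] theorem decodeFormula_all (x a : ℕ) :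
    decodeFormula (pair 3 (pair x a)) = .all x (decodeFormula a) := by
  rw [decodeFormula]; simp

@[simp] theorem decodeFormula_K (a : ℕ) :
    decodeFormula (pair 4 a) = .K (decodeFormula a) := by
  rw [decodeFormula]; simp

theorem decodeFormula_gnum (φ : LFormula) : decodeFormula φ.gnum = φ := by
  induction φ <;> simp_all [LFormula.gnum, decodeTerm_gnum]

/-- The list of pairs with a given code. -/
def decodePairs : ℕ → List (ℕ × ℕ)
  | 0 => []
  | n + 1 => (n.unpair.1, n.unpair.2.unpair.1) :: decodePairs n.unpair.2.unpair.2
decreasing_by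
  exact Nat.lt_succ_of_le ((Nat.unpair_right_le _).trans (Nat.unpair_right_le _))

@[simp] theorem decodePairs_zero : decodePairs 0 = [] := by rw [decodePairs]

@[simp] theorem decodePairs_consCode (x n e : ℕ) :
    decodePairs (consCode x n e) = (x, n) :: decodePairs e := by
  rw [consCode, decodePairs]; simp

/-- The name assigned to a variable by an environment; by default this is a generic name. -/
def lookup : List (ℕ × ℕ) → ℕ → ℕ
  | [], x => pair 0 x
  | (y, n) :: L, x => if x = y then n else lookup L x

/-- The size of a name, where generic names have size `0`. -/
def nameSize (n : ℕ) : ℕ := if n.unpair.1 = 0 then 0 else n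

theorem nameSize_le (n : ℕ) : nameSize n ≤ n := by
  unfold nameSize; split_ifs <;> omega

theorem nameSize_of_ne {n : ℕ} (h : n.unpair.1 ≠ 0) : nameSize n = n := if_neg h

theorem nameSize_lookup_le (e x : ℕ) : nameSize (lookup (decodePairs e) x) ≤ e := by
  induction e using Nat.strong_induction_on with
  | _ e ih =>
    cases e with
    | zero => simp [lookup, nameSize]
    | succ k =>
      have h₁ : k.unpair.2.unpair.1 ≤ k :=
        (Nat.unpair_left_le _).trans (Nat.unpair_right_le _)
      have h₂ : k.unpair.2.unpair.2 ≤ k :=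
        (Nat.unpair_right_le _).trans (Nat.unpair_right_le _)
      rw [decodePairs, lookup]
      split_ifs
      · exact (nameSize_le _).trans (by omega)
      · exact (ih _ (by omega)).trans (by omega)

namespace LStructure

variable (M : LStructure) (s : ℕ → M.U)

/-- The elements denoted by names in a structure, where `s` interprets the generic names. -/
noncomputable def denote (n : ℕ) : M.U :=
  if n.unpair.1 = 0 then s n.unpair.2
  else if n.unpair.1 = 1 then M.zero
  else if n.unpair.1 = 2 then M.succ (denote n.unpair.2)
  else if n.unpair.1 = 3 then
    M.add (denote n.unpair.2.unpair.1) (denote n.unpair.2.unpair.2)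
  else if n.unpair.1 = 4 then
    M.mul (denote n.unpair.2.unpair.1) (denote n.unpair.2.unpair.2)
  else
    @Classical.epsilon M.U M.nonempty fun u => ¬ M.Sat
      (Function.update (fun y => denote (lookup (decodePairs n.unpair.2.unpair.2) y))
        n.unpair.2.unpair.1.unpair.1 u)
      (decodeFormula n.unpair.2.unpair.1.unpair.2)
termination_by nameSize n
decreasing_by
  all_goals
    rw [nameSize_of_ne (n := n) ‹_›]
    first
      | exact (nameSize_le _).trans_lt (Nat.unpair_snd_lt ‹_›)
      | exact (nameSize_le _).trans_lt (Nat.unpair_snd_fst_lt ‹_›)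
      | exact (nameSize_le _).trans_lt (Nat.unpair_snd_snd_lt ‹_›)
      | exact (nameSize_lookup_le _ _).trans_lt (Nat.unpair_snd_snd_lt ‹_›)

/-- The assignment described by the environment with code `e`. -/
noncomputable def assign (e x : ℕ) : M.U := M.denote s (lookup (decodePairs e) x)

@[simp] theorem denote_generic (x : ℕ) : M.denote s (pair 0 x) = s x := by
  rw [denote]; simp

@[simp] theorem denote_zero : M.denote s (pair 1 0) = M.zero := by
  rw [denote]; simp

@[simp] theorem denote_succ (n : ℕ) : M.denote s (pair 2 n) = M.succ (M.denote s n) := by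
  rw [denote]; simp

@[simp] theorem denote_add (n m : ℕ) :
    M.denote s (pair 3 (pair n m)) = M.add (M.denote s n) (M.denote s m) := by
  rw [denote]; simp

@[simp] theorem denote_mul (n m : ℕ) :
    M.denote s (pair 4 (pair n m)) = M.mul (M.denote s n) (M.denote s m) := by
  rw [denote]; simp

@[simp] theorem assign_zero : M.assign s 0 = s := by
  funext x; simp [assign, lookup]

@[simp] theorem assign_consCode (x n e : ℕ) :
    M.assign s (consCode x n e) = Function.update (M.assign s e) x (M.denote s n) := by
  funext y
  by_cases h : y = x <;> simp [assign, lookup, h]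

theorem sat_all_of_sat_witness {x a e : ℕ}
    (h : M.Sat (M.assign s (consCode x (pair 5 (pair (pair x a) e)) e)) (decodeFormula a)) :
    M.Sat (M.assign s e) (.all x (decodeFormula a)) := by
  by_contra hall
  obtain ⟨u, hu⟩ := not_forall.1 hall
  have hε := @Classical.epsilon_spec M.U
    (fun u => ¬ M.Sat (Function.update (M.assign s e) x u) (decodeFormula a)) ⟨u, hu⟩
  rw [assign_consCode, denote] at h
  simp only [Nat.unpair_pair, OfNat.ofNat_ne_zero, OfNat.ofNat_ne_one, if_false,
    Nat.reduceEqDiff] at h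
  exact hε h

end LStructure

theorem LTerm.subst_eq_self {f : ℕ → LTerm} (t : LTerm) (h : ∀ x ∈ t.fv, f x = .var x) :
    t.subst f = t := by
  induction t <;> simp_all [LTerm.subst, LTerm.fv]

theorem LFormula.subst_eq_self {f : ℕ → LTerm} (φ : LFormula)
    (h : ∀ x ∈ φ.fv, f x = .var x) : φ.subst f = φ := by
  induction φ generalizing f with
  | eq t u =>
    simp only [fv, Finset.mem_union] at h
    rw [LFormula.subst, LTerm.subst_eq_self t fun x hx => h x (.inl hx),
      LTerm.subst_eq_self u fun x hx => h x (.inr hx)]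
  | falsum => rfl
  | imp a b iha ihb =>
    simp only [fv, Finset.mem_union] at h
    rw [LFormula.subst, iha fun x hx => h x (.inl hx), ihb fun x hx => h x (.inr hx)]
  | all y a ih =>
    rw [LFormula.subst, ih fun x hx => ?_]
    split_ifs with hxy
    · rw [hxy]
    · exact h x (Finset.mem_erase.2 ⟨hxy, hx⟩)
  | K a ih => rw [LFormula.subst, ih h]

theorem subst1_of_notMem {x : ℕ} {t : LTerm} {φ : LFormula} (h : x ∉ φ.fv) :
    subst1 x t φ = φ :=
  φ.subst_eq_self fun z hz => if_neg fun hzx : z = x => h (hzx ▸ hz)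

theorem subst1_all {x z : ℕ} {t : LTerm} {φ : LFormula} (h : x ≠ z) :
    subst1 x t (.all z φ) = .all z (subst1 x t φ) := by
  rw [subst1, LFormula.subst, subst1]
  congr 2
  funext w
  split_ifs <;> simp_all

namespace SatRel

/-- The relations holding in a structure. -/
noncomputable def ofStructure (M : LStructure) (s : ℕ → M.U) : SatRel where
  look e x n := lookup (decodePairs e) x = n
  val t e n := M.evalT (M.assign s e) (decodeTerm t) = M.denote s n
  eq n m := M.denote s n = M.denote s m
  tr φ e := M.Sat (M.assign s e) (decodeFormula φ)
  nfT x t := x ∉ (decodeTerm t).fv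
  nf x φ := x ∉ (decodeFormula φ).fv
  sbT x y t u := (decodeTerm t).subst (fun z => if z = x then .var y else .var z) = decodeTerm u
  sb x y φ ψ := SubstitutableVar y x (decodeFormula φ) ∧
    subst1 x (.var y) (decodeFormula φ) = decodeFormula ψ
  vc Γ x y := VarCorr (decodePairs Γ) x y
  alT Γ t u := TermAlpha (decodePairs Γ) (decodeTerm t) (decodeTerm u)
  al Γ φ ψ := FormulaAlpha (decodePairs Γ) (decodeFormula φ) (decodeFormula ψ)
  agT t e e' := ∀ x ∈ (decodeTerm t).fv, M.assign s e x = M.assign s e' x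
  ag φ e e' := ∀ x ∈ (decodeFormula φ).fv, M.assign s e x = M.assign s e' x
  tm t := ∃ u : LTerm, u.gnum = t
  fm φ := ∃ ψ : LFormula, ψ.gnum = φ

variable (M : LStructure) (s : ℕ → M.U)

theorem lookupRules_ofStructure : (ofStructure M s).LookupRules := by
  simp +contextual [LookupRules, ofStructure, lookup]

theorem valRules_ofStructure : (ofStructure M s).ValRules := by
  simp +contextual [ValRules, ofStructure, LStructure.evalT, LStructure.assign]

theorem eqRules_ofStructure : (ofStructure M s).EqRules := by
  simp +contextual [EqRules, ofStructure]

theorem truthRules_ofStructure : (ofStructure M s).TruthRules := by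
  refine ⟨?_, ?_, ?_, ?_, ?_, ?_, ?_, ?_⟩
  case refine_8 =>
    intro x a e h
    simpa only [ofStructure, decodeFormula_all] using M.sat_all_of_sat_witness s h
  all_goals simp +contextual [ofStructure, LStructure.Sat]
  exact fun a b e => Classical.or_iff_not_imp_left.2 fun h h' => absurd h' h

theorem modalRules_ofStructure (hM : IsLStructure M) : (ofStructure M s).ModalRules := by
  obtain ⟨ha, hb, hc⟩ := hM
  simp only [ModalRules, ofStructure, decodeFormula_K, decodePairs_zero, LStructure.Sat,
    LStructure.assign_consCode]
  refine ⟨fun φ e e' h => (ha _ _ _ h).1, fun φ ψ e h => (hb _ _ _ h).1,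
    fun φ ψ e h => (hb _ _ _ h).2, ?_, ?_⟩
  · rintro φ ψ x y n e ⟨h, h'⟩ rfl
    rw [← h']
    exact (hc _ _ _ _ h).1
  · rintro φ ψ x y n e ⟨h, h'⟩ rfl
    rw [← h']
    exact (hc _ _ _ _ h).2

theorem notFreeRules_ofStructure : (ofStructure M s).NotFreeRules := by
  simp +contextual [NotFreeRules, ofStructure, LTerm.fv, LFormula.fv]

theorem substRules_ofStructure : (ofStructure M s).SubstRules := by
  refine ⟨?_, ?_, ?_, ?_, ?_, ?_, ?_, ?_, ?_, ?_, ?_, ?_⟩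
  case refine_10 =>
    intro x y z a h
    simp only [ofStructure, decodeFormula_all] at h ⊢
    exact ⟨.inl h, subst1_of_notMem h⟩
  case refine_11 =>
    rintro x y z a a' hxz hyz ⟨h, h'⟩
    simp only [ofStructure, decodeFormula_all]
    exact ⟨.inr ⟨hyz, h⟩, by rw [subst1_all hxz, h']⟩
  all_goals
    simp +contextual [ofStructure, LTerm.subst, subst1, LFormula.subst, SubstitutableVar]

theorem alphaRules_ofStructure : (ofStructure M s).AlphaRules := by
  simp +contextual [AlphaRules, ofStructure, VarCorr, TermAlpha, FormulaAlpha]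

theorem agreeRules_ofStructure : (ofStructure M s).AgreeRules := by
  refine ⟨?_, ?_, ?_, ?_, ?_, ?_, ?_, ?_, ?_, ?_⟩
  case refine_9 =>
    intro x a e e' h y hy
    simp only [decodeFormula_all, LFormula.fv, Finset.mem_erase] at hy
    simpa [hy.1] using h y hy.2
  case refine_1 =>
    rintro x e e' n m rfl rfl h
    simpa [ofStructure, LTerm.fv, LStructure.assign] using h
  all_goals simp +contextual [ofStructure, LTerm.fv, LFormula.fv, or_imp]

theorem codeRules_ofStructure : (ofStructure M s).CodeRules := by
  refine ⟨fun x => ⟨.var x, rfl⟩, ⟨.zero, rfl⟩, ?_, ?_, ?_, ?_, ⟨.falsum, rfl⟩, ?_, ?_, ?_⟩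
  · rintro _ ⟨t, rfl⟩; exact ⟨.succ t, rfl⟩
  · rintro _ _ ⟨t, rfl⟩ ⟨u, rfl⟩; exact ⟨.add t u, rfl⟩
  · rintro _ _ ⟨t, rfl⟩ ⟨u, rfl⟩; exact ⟨.mul t u, rfl⟩
  · rintro _ _ ⟨t, rfl⟩ ⟨u, rfl⟩; exact ⟨.eq t u, rfl⟩
  · rintro _ _ ⟨a, rfl⟩ ⟨b, rfl⟩; exact ⟨.imp a b, rfl⟩
  · rintro x _ ⟨a, rfl⟩; exact ⟨.all x a, rfl⟩
  · rintro _ ⟨a, rfl⟩; exact ⟨.K a, rfl⟩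

theorem refutes_ofStructure (hM : IsLStructure M) {k : ℕ}
    (hk : ∀ φ : LFormula, φ.gnum = k → ¬ M.Sat s φ) : (ofStructure M s).Refutes k where
  look := lookupRules_ofStructure M s
  val := valRules_ofStructure M s
  eq := eqRules_ofStructure M s
  truth := truthRules_ofStructure M s
  modal := modalRules_ofStructure M s hM
  notFree := notFreeRules_ofStructure M s
  subst := substRules_ofStructure M s
  alpha := alphaRules_ofStructure M s
  agree := agreeRules_ofStructure M s
  code := codeRules_ofStructure M s
  goal := by
    rintro ⟨φ, rfl⟩ h
    simp only [ofStructure, decodeFormula_gnum, LStructure.assign_zero] at h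
    exact hk φ rfl h

end SatRel

/-- The code of a list of pairs. -/
def pairsCode : List (ℕ × ℕ) → ℕ
  | [] => 0
  | (x, n) :: L => consCode x n (pairsCode L)

/-- The name of the value of a term in an environment. -/
def LTerm.evalName (L : List (ℕ × ℕ)) : LTerm → ℕ
  | var x => lookup L x
  | zero => pair 1 0
  | succ t => pair 2 (t.evalName L)
  | add t u => pair 3 (pair (t.evalName L) (u.evalName L))
  | mul t u => pair 4 (pair (t.evalName L) (u.evalName L))

namespace SatRel

variable {D : SatRel}

theorem LookupRules.look_lookup (h : D.LookupRules) (L : List (ℕ × ℕ)) (x : ℕ) :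
    D.look (pairsCode L) x (lookup L x) := by
  obtain ⟨h₁, h₂, h₃⟩ := h
  induction L with
  | nil => exact h₁ x
  | cons p L ih =>
    rw [pairsCode, lookup]
    split_ifs with hx
    · exact hx ▸ h₂ _ _ _
    · exact h₃ _ _ _ _ _ hx ih

theorem ValRules.val_evalName (h : D.ValRules) (hl : D.LookupRules) (L : List (ℕ × ℕ))
    (t : LTerm) : D.val t.gnum (pairsCode L) (t.evalName L) := by
  obtain ⟨h₁, h₂, h₃, h₄, h₅⟩ := h
  induction t with
  | var x => exact h₁ _ _ _ (hl.look_lookup L x)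
  | zero => exact h₂ _
  | succ t iht => exact h₃ _ _ _ iht
  | add t u iht ihu => exact h₄ _ _ _ _ _ iht ihu
  | mul t u iht ihu => exact h₅ _ _ _ _ _ iht ihu

theorem NotFreeRules.nfT_gnum (h : D.NotFreeRules) {x : ℕ} {t : LTerm} (hx : x ∉ t.fv) :
    D.nfT x t.gnum := by
  obtain ⟨h₁, h₂, h₃, h₄, h₅, -⟩ := h
  induction t with
  | var y => exact h₁ _ _ (by simpa [LTerm.fv] using hx)
  | zero => exact h₂ _
  | succ t iht => exact h₃ _ _ (iht hx)
  | add t u iht ihu =>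
    simp only [LTerm.fv, Finset.mem_union, not_or] at hx
    exact h₄ _ _ _ (iht hx.1) (ihu hx.2)
  | mul t u iht ihu =>
    simp only [LTerm.fv, Finset.mem_union, not_or] at hx
    exact h₅ _ _ _ (iht hx.1) (ihu hx.2)

theorem NotFreeRules.nf_gnum (h : D.NotFreeRules) {x : ℕ} {φ : LFormula} (hx : x ∉ φ.fv) :
    D.nf x φ.gnum := by
  obtain ⟨-, -, -, -, -, h₁, h₂, h₃, h₄, h₅, h₆⟩ := id h
  induction φ with
  | eq t u =>
    simp only [LFormula.fv, Finset.mem_union, not_or] at hx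
    exact h₁ _ _ _ (h.nfT_gnum hx.1) (h.nfT_gnum hx.2)
  | falsum => exact h₂ _
  | imp a b iha ihb =>
    simp only [LFormula.fv, Finset.mem_union, not_or] at hx
    exact h₃ _ _ _ (iha hx.1) (ihb hx.2)
  | all y a ih =>
    by_cases hxy : x = y
    · exact hxy ▸ h₄ _ _
    · exact h₅ _ _ _ (ih fun ha => hx (Finset.mem_erase.2 ⟨hxy, ha⟩))
  | K a ih => exact h₆ _ _ (ih hx)

theorem SubstRules.sbT_gnum (h : D.SubstRules) (x y : ℕ) (t : LTerm) :
    D.sbT x y t.gnum (t.subst fun z => if z = x then .var y else .var z).gnum := by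
  obtain ⟨h₁, h₂, h₃, h₄, h₅, h₆, -⟩ := h
  induction t with
  | var z =>
    rw [LTerm.subst]
    split_ifs with hz
    · exact hz ▸ h₁ _ _
    · exact h₂ _ _ _ hz
  | zero => exact h₃ _ _
  | succ t iht => exact h₄ _ _ _ _ iht
  | add t u iht ihu => exact h₅ _ _ _ _ _ _ iht ihu
  | mul t u iht ihu => exact h₆ _ _ _ _ _ _ iht ihu

theorem SubstRules.sb_gnum (h : D.SubstRules) (hn : D.NotFreeRules) {x y : ℕ} {φ : LFormula}
    (hφ : SubstitutableVar y x φ) : D.sb x y φ.gnum (subst1 x (.var y) φ).gnum := by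
  obtain ⟨-, -, -, -, -, -, h₁, h₂, h₃, h₄, h₅, h₆⟩ := id h
  induction φ with
  | eq t u => exact h₁ _ _ _ _ _ _ (h.sbT_gnum x y t) (h.sbT_gnum x y u)
  | falsum => exact h₂ _ _
  | imp a b iha ihb => exact h₃ _ _ _ _ _ _ (iha hφ.1) (ihb hφ.2)
  | all z a ih =>
    by_cases hx : x ∈ (LFormula.all z a).fv
    · obtain ⟨hyz, ha⟩ := hφ.resolve_left (not_not.2 hx)
      have hxz : x ≠ z := (Finset.mem_erase.1 hx).1
      rw [subst1_all hxz]
      exact h₅ _ _ _ _ _ hxz hyz (ih ha)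
    · rw [subst1_of_notMem hx]
      exact h₄ _ _ _ _ (hn.nf_gnum hx)
  | K a ih => exact h₆ _ _ _ _ (ih hφ)

theorem AlphaRules.vc_of_varCorr (h : D.AlphaRules) {Γ : List (ℕ × ℕ)} {x y : ℕ}
    (hxy : VarCorr Γ x y) : D.vc (pairsCode Γ) x y := by
  obtain ⟨h₁, h₂, h₃, -⟩ := h
  induction Γ with
  | nil =>
    cases hxy
    exact h₁ _
  | cons p Γ ih =>
    obtain ⟨rfl, rfl⟩ | ⟨hx, hy, hΓ⟩ := hxy
    · exact h₂ _ _ _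
    · exact h₃ _ _ _ _ _ hx hy (ih hΓ)

theorem AlphaRules.alT_of_termAlpha (h : D.AlphaRules) {Γ : List (ℕ × ℕ)} {t t' : LTerm}
    (ht : TermAlpha Γ t t') : D.alT (pairsCode Γ) t.gnum t'.gnum := by
  obtain ⟨-, -, -, h₁, h₂, h₃, h₄, h₅, -⟩ := id h
  induction t generalizing t' with
  | var x => cases t' <;> first | exact ht.elim | exact h₁ _ _ _ (h.vc_of_varCorr ht)
  | zero => cases t' <;> first | exact ht.elim | exact h₂ _
  | succ t iht => cases t' <;> first | exact ht.elim | exact h₃ _ _ _ (iht ht)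
  | add t u iht ihu =>
    cases t' <;> first | exact ht.elim | exact h₄ _ _ _ _ _ (iht ht.1) (ihu ht.2)
  | mul t u iht ihu =>
    cases t' <;> first | exact ht.elim | exact h₅ _ _ _ _ _ (iht ht.1) (ihu ht.2)

theorem AlphaRules.al_of_formulaAlpha (h : D.AlphaRules) {Γ : List (ℕ × ℕ)} {φ ψ : LFormula}
    (hφ : FormulaAlpha Γ φ ψ) : D.al (pairsCode Γ) φ.gnum ψ.gnum := by
  obtain ⟨-, -, -, -, -, -, -, -, h₁, h₂, h₃, h₄, h₅⟩ := id h
  induction φ generalizing Γ ψ with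
  | eq t u =>
    cases ψ <;> simp only [FormulaAlpha] at hφ
    exact h₁ _ _ _ _ _ (h.alT_of_termAlpha hφ.1) (h.alT_of_termAlpha hφ.2)
  | falsum =>
    cases ψ <;> simp only [FormulaAlpha] at hφ
    exact h₂ _
  | imp a b iha ihb =>
    cases ψ <;> simp only [FormulaAlpha] at hφ
    exact h₃ _ _ _ _ _ (iha hφ.1) (ihb hφ.2)
  | all x a ih =>
    cases ψ <;> simp only [FormulaAlpha] at hφ
    exact h₄ _ _ _ _ _ (ih hφ)
  | K a ih =>
    cases ψ <;> simp only [FormulaAlpha] at hφ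
    exact h₅ _ _ _ (ih hφ)

theorem AgreeRules.agT_gnum (h : D.AgreeRules) (hl : D.LookupRules) {L L' : List (ℕ × ℕ)}
    {t : LTerm} (ht : ∀ x ∈ t.fv, D.eq (lookup L x) (lookup L' x)) :
    D.agT t.gnum (pairsCode L) (pairsCode L') := by
  obtain ⟨h₁, h₂, h₃, h₄, h₅, -⟩ := h
  induction t with
  | var x =>
    exact h₁ _ _ _ _ _ (hl.look_lookup L x) (hl.look_lookup L' x) (ht x (by simp [LTerm.fv]))
  | zero => exact h₂ _ _
  | succ t iht => exact h₃ _ _ _ (iht ht)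
  | add t u iht ihu =>
    simp only [LTerm.fv, Finset.mem_union] at ht
    exact h₄ _ _ _ _ (iht fun x hx => ht x (.inl hx)) (ihu fun x hx => ht x (.inr hx))
  | mul t u iht ihu =>
    simp only [LTerm.fv, Finset.mem_union] at ht
    exact h₅ _ _ _ _ (iht fun x hx => ht x (.inl hx)) (ihu fun x hx => ht x (.inr hx))

theorem AgreeRules.ag_gnum (h : D.AgreeRules) (hl : D.LookupRules) (he : D.EqRules)
    {L L' : List (ℕ × ℕ)} {φ : LFormula}
    (hφ : ∀ x ∈ φ.fv, D.eq (lookup L x) (lookup L' x)) :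
    D.ag φ.gnum (pairsCode L) (pairsCode L') := by
  obtain ⟨-, -, -, -, -, h₁, h₂, h₃, h₄, h₅⟩ := id h
  induction φ generalizing L L' with
  | eq t u =>
    simp only [LFormula.fv, Finset.mem_union] at hφ
    exact h₁ _ _ _ _ (h.agT_gnum hl fun x hx => hφ x (.inl hx))
      (h.agT_gnum hl fun x hx => hφ x (.inr hx))
  | falsum => exact h₂ _ _
  | imp a b iha ihb =>
    simp only [LFormula.fv, Finset.mem_union] at hφ
    exact h₃ _ _ _ _ (iha fun x hx => hφ x (.inl hx)) (ihb fun x hx => hφ x (.inr hx))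
  | all y a ih =>
    refine h₄ _ _ _ _ (ih (L := (y, 0) :: L) (L' := (y, 0) :: L') fun x hx => ?_)
    rw [lookup, lookup]
    split_ifs with hxy
    · exact he.1 _
    · exact hφ x (Finset.mem_erase.2 ⟨hxy, hx⟩)
  | K a ih => exact h₅ _ _ _ (ih hφ)

theorem CodeRules.tm_gnum (h : D.CodeRules) (t : LTerm) : D.tm t.gnum := by
  obtain ⟨h₁, h₂, h₃, h₄, h₅, -⟩ := h
  induction t with
  | var x => exact h₁ _
  | zero => exact h₂
  | succ t iht => exact h₃ _ iht
  | add t u iht ihu => exact h₄ _ _ iht ihu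
  | mul t u iht ihu => exact h₅ _ _ iht ihu

theorem CodeRules.fm_gnum (h : D.CodeRules) (φ : LFormula) : D.fm φ.gnum := by
  obtain ⟨-, -, -, -, -, h₁, h₂, h₃, h₄, h₅⟩ := id h
  induction φ with
  | eq t u => exact h₁ _ _ (h.tm_gnum t) (h.tm_gnum u)
  | falsum => exact h₂
  | imp a b iha ihb => exact h₃ _ _ iha ihb
  | all y a ih => exact h₄ _ _ ih
  | K a ih => exact h₅ _ ih

/-- Equality of the elements denoted by names. -/
def EqRules.setoid (h : D.EqRules) : Setoid ℕ where
  r := D.eq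
  iseqv := ⟨h.1, fun {_ _} => h.2.1 _ _, fun {_ _ _} => h.2.2.1 _ _ _⟩

/-- The term model of a set of relations satisfying the rules for equality. -/
def EqRules.termModel (h : D.EqRules) : LStructure where
  U := Quotient h.setoid
  nonempty := ⟨Quotient.mk _ 0⟩
  zero := Quotient.mk _ (pair 1 0)
  succ := Quotient.map (fun n => pair 2 n) fun _ _ => h.2.2.2.1 _ _
  add := Quotient.map₂ (fun n m => pair 3 (pair n m)) fun _ _ h₁ _ _ => h.2.2.2.2.1 _ _ _ _ h₁
  mul := Quotient.map₂ (fun n m => pair 4 (pair n m)) fun _ _ h₁ _ _ => h.2.2.2.2.2 _ _ _ _ h₁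
  satK s φ := ∃ L : List (ℕ × ℕ), (∀ x ∈ φ.fv, s x = Quotient.mk h.setoid (lookup L x)) ∧
    D.tr (LFormula.K φ).gnum (pairsCode L)

/-- The element denoted by a name in the term model. -/
def EqRules.mk (h : D.EqRules) (n : ℕ) : h.termModel.U := Quotient.mk _ n

theorem EqRules.mk_eq_mk (h : D.EqRules) {n m : ℕ} : h.mk n = h.mk m ↔ D.eq n m :=
  Quotient.eq (r := h.setoid)

theorem EqRules.exists_lookup (h : D.EqRules) (s : ℕ → h.termModel.U) (F : Finset ℕ) :
    ∃ L : List (ℕ × ℕ), ∀ x ∈ F, s x = h.mk (lookup L x) := by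
  induction F using Finset.induction_on with
  | empty => exact ⟨[], by simp⟩
  | insert a F _ ih =>
    obtain ⟨L, hL⟩ := ih
    obtain ⟨n, hn⟩ := Quotient.exists_rep (s a)
    refine ⟨(a, n) :: L, fun x hx => ?_⟩
    rw [lookup]
    split_ifs with hxa
    · rw [hxa]; exact hn.symm
    · exact hL x (Finset.mem_of_mem_insert_of_ne hx hxa)

theorem EqRules.evalT_termModel (h : D.EqRules) (L : List (ℕ × ℕ)) (t : LTerm) :
    h.termModel.evalT (fun x => h.mk (lookup L x)) t = h.mk (t.evalName L) := by
  induction t with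
  | var x => rfl
  | zero => rfl
  | succ t iht => rw [LStructure.evalT, iht]; rfl
  | add t u iht ihu => rw [LStructure.evalT, iht, ihu]; rfl
  | mul t u iht ihu => rw [LStructure.evalT, iht, ihu]; rfl

namespace Refutes

theorem satK_termModel_iff {k : ℕ} (h : D.Refutes k) {L : List (ℕ × ℕ)}
    {s : ℕ → h.eq.termModel.U} {φ : LFormula} (hL : ∀ x ∈ φ.fv, s x = h.eq.mk (lookup L x)) :
    h.eq.termModel.satK s φ ↔ D.tr (LFormula.K φ).gnum (pairsCode L) := by
  refine ⟨?_, fun ht => ⟨L, hL, ht⟩⟩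
  rintro ⟨L', hL', ht⟩
  refine h.modal.1 _ _ _ (h.agree.ag_gnum h.look h.eq fun x hx => ?_) ht
  exact h.eq.mk_eq_mk.1 ((hL' x hx).symm.trans (hL x hx))

theorem isLStructure_termModel {k : ℕ} (h : D.Refutes k) :
    IsLStructure h.eq.termModel := by
  obtain ⟨-, h₁, h₂, h₃, h₄⟩ := h.modal
  refine ⟨fun φ s t hst => ?_, fun φ ψ s hφ => ?_, fun φ x y s hφ => ?_⟩
  · obtain ⟨L, hL⟩ := h.eq.exists_lookup s φ.fv
    rw [h.satK_termModel_iff hL,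
      h.satK_termModel_iff (s := t) fun x hx => (hst x hx).symm.trans (hL x hx)]
  · obtain ⟨L, hL⟩ := h.eq.exists_lookup s (φ.fv ∪ ψ.fv)
    rw [h.satK_termModel_iff fun x hx => hL x (Finset.mem_union_left _ hx),
      h.satK_termModel_iff fun x hx => hL x (Finset.mem_union_right _ hx)]
    have := h.alpha.al_of_formulaAlpha hφ
    exact ⟨h₁ _ _ _ this, h₂ _ _ _ this⟩
  · obtain ⟨L, hL⟩ :=
      h.eq.exists_lookup s (insert y (φ.fv ∪ (subst1 x (.var y) φ).fv))
    simp only [Finset.mem_insert, Finset.mem_union] at hL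
    rw [h.satK_termModel_iff (L := L) fun z hz => hL z (.inr (.inr hz)),
      h.satK_termModel_iff (L := (x, lookup L y) :: L) fun z hz => ?_]
    · have hs := h.subst.sb_gnum h.notFree hφ
      have hy := h.look.look_lookup L y
      exact ⟨h₃ _ _ _ _ _ _ hs hy, h₄ _ _ _ _ _ _ hs hy⟩
    · rw [lookup]
      split_ifs with hzx
      · rw [hzx, Function.update_self]; exact hL y (.inl rfl)
      · rw [Function.update_of_ne hzx]; exact hL z (.inr (.inl hz))

theorem sat_termModel_iff {k : ℕ} (h : D.Refutes k) (L : List (ℕ × ℕ))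
    (φ : LFormula) :
    h.eq.termModel.Sat (fun x => h.eq.mk (lookup L x)) φ ↔ D.tr φ.gnum (pairsCode L) := by
  obtain ⟨h₁, h₂, h₃, h₄, h₅, h₆, h₇, h₈⟩ := h.truth
  induction φ generalizing L with
  | eq t u =>
    rw [LStructure.Sat, h.eq.evalT_termModel, h.eq.evalT_termModel, h.eq.mk_eq_mk]
    have ht := h.val.val_evalName h.look L t
    have hu := h.val.val_evalName h.look L u
    exact ⟨h₂ _ _ _ _ _ ht hu, h₁ _ _ _ _ _ ht hu⟩
  | falsum => exact ⟨False.elim, h₃ _⟩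
  | imp a b iha ihb =>
    rw [LStructure.Sat, iha, ihb]
    refine ⟨fun hab => ?_, h₄ _ _ _⟩
    exact (h₅ a.gnum b.gnum (pairsCode L)).elim (fun ha => h₆ _ _ _ (hab ha)) id
  | all x a ih =>
    have hupd : ∀ n, Function.update (fun y => h.eq.mk (lookup L y)) x (h.eq.mk n) =
        fun y => h.eq.mk (lookup ((x, n) :: L) y) := by
      intro n
      funext y
      by_cases hy : y = x <;> simp [lookup, hy]
    have hsat : ∀ n, h.eq.termModel.Sat
        (Function.update (fun y => h.eq.mk (lookup L y)) x (h.eq.mk n)) a ↔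
        D.tr a.gnum (consCode x n (pairsCode L)) := by
      intro n
      rw [hupd]
      exact ih ((x, n) :: L)
    refine ⟨fun ha => h₈ _ _ _ ((hsat _).1 (ha _)), fun ha u => ?_⟩
    obtain ⟨n, rfl⟩ := Quotient.exists_rep u
    exact (hsat n).2 (h₇ _ _ _ _ ha)
  | K a _ => exact h.satK_termModel_iff fun _ _ => rfl

theorem not_valid {φ : LFormula} (h : D.Refutes φ.gnum) : ¬ Valid φ := by
  intro hφ
  refine h.goal (h.code.fm_gnum φ) ((h.sat_termModel_iff [] φ).1 ?_)
  exact hφ _ h.isLStructure_termModel (fun _ hσ => hσ.elim) _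

end Refutes

theorem exists_refutes {k : ℕ} (hk : ¬ ∃ φ : LFormula, Valid φ ∧ k = φ.gnum) :
    ∃ D : SatRel, D.Refutes k := by
  by_cases hcode : ∃ φ : LFormula, φ.gnum = k
  · obtain ⟨φ, rfl⟩ := hcode
    have hφ : ¬ Valid φ := fun hφ => hk ⟨φ, hφ, rfl⟩
    simp only [Valid, Consequence, LStructure.Models, not_forall] at hφ
    obtain ⟨M, hM, -, s, hs⟩ := hφ
    refine ⟨_, refutes_ofStructure M s hM fun ψ hψ => ?_⟩
    rwa [← decodeFormula_gnum ψ, hψ, decodeFormula_gnum]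
  · have hM : IsLStructure StdModel :=
      ⟨fun _ _ _ _ => Iff.rfl, fun _ _ _ _ => Iff.rfl, fun _ _ _ _ _ => Iff.rfl⟩
    exact ⟨_, refutes_ofStructure StdModel (fun _ => (0 : ℕ)) hM fun φ hφ =>
      absurd ⟨φ, hφ⟩ hcode⟩

end SatRel

/-- The set of valid 𝓛-formulas is recursively enumerable
(identifying a set of formulas with the set of Gödel numbers of its elements). -/
theorem valid_formulas_re :
    ∃ e : ℕ, W e = {k : ℕ | ∃ φ : LFormula, Valid φ ∧ k = φ.gnum} := by
  obtain ⟨e, he⟩ := REPred.exists_W (Clausal.rePred_unsat SatRel.clausal_refutes)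
  refine ⟨e, he.trans (Set.ext fun k => ⟨fun hk => ?_, ?_⟩)⟩
  · by_contra hv
    obtain ⟨D, hD⟩ := SatRel.exists_refutes hv
    obtain ⟨V, rfl⟩ := D.exists_ofVal
    exact hk V hD
  · rintro ⟨φ, hφ, rfl⟩ V hV
    exact hV.not_valid hφ
end

section
/- If Σ is a set of 𝓛-sentences and Σ ⊨ φ, then there are finitely many σ₁, …, σₙ ∈ Σ such that the formula σ₁ → (σ₂ → (⋯ → (σₙ → φ)⋯)) is valid. -/
namespace LStructure

/-- Satisfaction of a formula depends only on the values of its free variables. -/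
theorem sat_congr {M : LStructure} (hM : IsLStructure M) (φ : LFormula) {s t : ℕ → M.U}
    (h : ∀ x ∈ φ.fv, s x = t x) : M.Sat s φ ↔ M.Sat t φ := by
  have evalT_congr (u : LTerm) {s t : ℕ → M.U} (h : ∀ x ∈ u.fv, s x = t x) :
      M.evalT s u = M.evalT t u := by
    induction u with
    | var n => exact h n (by simp [LTerm.fv])
    | zero => rfl
    | succ u ih => exact congrArg M.succ (ih h)
    | add u v ihu ihv =>
      exact congrArg₂ M.add (ihu fun x hx => h x (Finset.mem_union_left _ hx))
        (ihv fun x hx => h x (Finset.mem_union_right _ hx))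
    | mul u v ihu ihv =>
      exact congrArg₂ M.mul (ihu fun x hx => h x (Finset.mem_union_left _ hx))
        (ihv fun x hx => h x (Finset.mem_union_right _ hx))
  induction φ generalizing s t with
  | eq u v =>
    simp only [Sat]
    rw [evalT_congr u fun x hx => h x (Finset.mem_union_left _ hx),
      evalT_congr v fun x hx => h x (Finset.mem_union_right _ hx)]
  | falsum => rfl
  | imp a b iha ihb =>
    exact imp_congr (iha fun x hx => h x (Finset.mem_union_left _ hx))
      (ihb fun x hx => h x (Finset.mem_union_right _ hx))
  | all y a ih =>
    refine forall_congr' fun u => ih fun x hx => ?_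
    by_cases hxy : x = y
    · subst hxy; simp
    · simpa [hxy] using h x (Finset.mem_erase.2 ⟨hxy, hx⟩)
  | K a => exact hM.1 a s t h

/-- A chain of implications `σ₁ → ⋯ → σₙ → φ` fails exactly when all the hypotheses hold
and the conclusion fails. -/
theorem not_sat_foldr_imp (M : LStructure) (s : ℕ → M.U) (l : List LFormula) (φ : LFormula) :
    ¬ M.Sat s (l.foldr LFormula.imp φ) ↔ (∀ σ ∈ l, M.Sat s σ) ∧ ¬ M.Sat s φ := by
  induction l with
  | nil => simp
  | cons σ l ih => simp [Sat, ih, and_assoc]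

section Ultraproduct

variable {ι : Type} (𝒰 : Ultrafilter ι) (M : ι → LStructure)

/-- The ultraproduct of a family of structures; `K φ` holds at an assignment when it holds
in almost every factor at the chosen representatives of that assignment. -/
noncomputable def ultraproduct : LStructure where
  U := (𝒰 : Filter ι).Product fun i => (M i).U
  nonempty := ⟨Quotient.mk _ fun i => (M i).nonempty.some⟩
  zero := Quotient.mk _ fun i => (M i).zero
  succ := Quotient.map (fun f i => (M i).succ (f i)) fun _ _ h =>
    h.mono fun i hi => congrArg (M i).succ hi
  add := Quotient.map₂ (fun f g i => (M i).add (f i) (g i)) fun _ _ h _ _ h' =>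
    h.mp (h'.mono fun i hi' hi => congrArg₂ (M i).add hi hi')
  mul := Quotient.map₂ (fun f g i => (M i).mul (f i) (g i)) fun _ _ h _ _ h' =>
    h.mp (h'.mono fun i hi' hi => congrArg₂ (M i).mul hi hi')
  satK s φ := ∀ᶠ i in (𝒰 : Filter ι), (M i).satK (fun n => (s n).out i) φ

/-- The class in the ultraproduct of a choice of elements of the factors. -/
def toUltraproduct (f : ∀ i, (M i).U) : (ultraproduct 𝒰 M).U :=
  Quotient.mk ((𝒰 : Filter ι).productSetoid fun i => (M i).U) f

variable {𝒰 M}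

theorem toUltraproduct_eq {f g : ∀ i, (M i).U} :
    toUltraproduct 𝒰 M f = toUltraproduct 𝒰 M g ↔ ∀ᶠ i in (𝒰 : Filter ι), f i = g i :=
  Quotient.eq

theorem exists_toUltraproduct_eq (u : (ultraproduct 𝒰 M).U) :
    ∃ f, toUltraproduct 𝒰 M f = u :=
  Quotient.exists_rep u

theorem isLStructure_ultraproduct (hM : ∀ i, IsLStructure (M i)) :
    IsLStructure (ultraproduct 𝒰 M) := by
  refine ⟨fun φ s t h => ?_, fun φ ψ s h => ?_, fun φ x y s h => ?_⟩
  · exact Filter.eventually_congr (.of_forall fun i =>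
      (hM i).1 φ _ _ fun x hx => by rw [h x hx])
  · exact Filter.eventually_congr (.of_forall fun i => (hM i).2.1 φ ψ _ h)
  · refine Filter.eventually_congr (.of_forall fun i => ?_)
    rw [(hM i).2.2 φ x y _ h]
    refine iff_of_eq (congrArg (fun s => (M i).satK s φ) (funext fun n => ?_))
    by_cases hn : n = x
    · subst hn; simp
    · simp [hn]

theorem evalT_ultraproduct (f : ℕ → ∀ i, (M i).U) (t : LTerm) :
    (ultraproduct 𝒰 M).evalT (fun n => toUltraproduct 𝒰 M (f n)) t =
      toUltraproduct 𝒰 M fun i => (M i).evalT (fun n => f n i) t := by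
  induction t with
  | var n => rfl
  | zero => rfl
  | succ t ih => simp only [evalT, ih]; rfl
  | add t u iht ihu => simp only [evalT, iht, ihu]; rfl
  | mul t u iht ihu => simp only [evalT, iht, ihu]; rfl

/-- The theorem of Łoś: satisfaction in an ultraproduct is satisfaction in almost every factor. -/
theorem sat_ultraproduct (hM : ∀ i, IsLStructure (M i)) (f : ℕ → ∀ i, (M i).U)
    (φ : LFormula) :
    (ultraproduct 𝒰 M).Sat (fun n => toUltraproduct 𝒰 M (f n)) φ ↔
      ∀ᶠ i in (𝒰 : Filter ι), (M i).Sat (fun n => f n i) φ := by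
  induction φ generalizing f with
  | eq t u => simp only [Sat, evalT_ultraproduct, toUltraproduct_eq]
  | falsum => simp [Sat, 𝒰.neBot.ne]
  | imp a b iha ihb => simp only [Sat, iha, ihb, Ultrafilter.eventually_imp]
  | all x a ih =>
    have update_toUltraproduct (g : ∀ i, (M i).U) :
        (ultraproduct 𝒰 M).Sat (Function.update (fun n => toUltraproduct 𝒰 M (f n)) x
          (toUltraproduct 𝒰 M g)) a ↔
        ∀ᶠ i in (𝒰 : Filter ι), (M i).Sat (Function.update (fun n => f n i) x (g i)) a := by
      have apply_update {β : Type} (F : (∀ i, (M i).U) → β) :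
          Function.update (fun n => F (f n)) x (F g) = fun n => F (Function.update f x g n) :=
        funext fun n => (Function.apply_update (fun _ => F) f x g n).symm
      rw [apply_update, ih]
      exact Filter.eventually_congr (.of_forall fun i => by rw [apply_update fun g => g i])
    simp only [Sat]
    constructor
    · intro h
      have (i : ι) : ∃ u, (M i).Sat (Function.update (fun n => f n i) x u) a →
          ∀ v, (M i).Sat (Function.update (fun n => f n i) x v) a := by
        have := (M i).nonempty
        by_cases hi : ∀ v, (M i).Sat (Function.update (fun n => f n i) x v) a
        · exact ⟨Classical.arbitrary _, fun _ => hi⟩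
        · obtain ⟨v, hv⟩ := not_forall.1 hi
          exact ⟨v, fun h => absurd h hv⟩
      choose g hg using this
      exact ((update_toUltraproduct g).1 (h _)).mono hg
    · intro h u
      obtain ⟨g, rfl⟩ := exists_toUltraproduct_eq u
      exact (update_toUltraproduct g).2 (h.mono fun i hi => hi (g i))
  | K a =>
    have h : ∀ᶠ i in (𝒰 : Filter ι), ∀ x ∈ a.fv,
        Quotient.out (toUltraproduct 𝒰 M (f x)) i = f x i :=
      (Filter.eventually_all_finset _).2 fun x _ =>
        toUltraproduct_eq.1 (Quotient.out_eq (toUltraproduct 𝒰 M (f x)))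
    exact Filter.eventually_congr (h.mono fun i hi => (hM i).1 a _ _ hi)

end Ultraproduct

end LStructure

/-- If Σ is a set of 𝓛-sentences and Σ ⊨ φ, then there are finitely many
σ₁, …, σₙ ∈ Σ such that σ₁ → (σ₂ → (⋯ → (σₙ → φ)⋯)) is valid. -/
theorem consequence_compactness (T : Set LFormula) (hsent : ∀ σ ∈ T, σ.fv = ∅)
    (φ : LFormula) (h : Consequence T φ) :
    ∃ l : List LFormula, (∀ σ ∈ l, σ ∈ T) ∧ Valid (l.foldr LFormula.imp φ) := by
  by_contra! hno
  have (F : Finset T) : ∃ M : LStructure, IsLStructure M ∧ ∃ s : ℕ → M.U,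
      (∀ σ ∈ F, M.Sat s σ) ∧ ¬ M.Sat s φ := by
    have hF := hno (F.toList.map Subtype.val) (by simp +contextual)
    simp only [Valid, Consequence, LStructure.Models, not_forall] at hF
    obtain ⟨M, hM, -, s, hs⟩ := hF
    rw [LStructure.not_sat_foldr_imp] at hs
    exact ⟨M, hM, s, fun σ hσ => hs.1 σ (List.mem_map_of_mem (Finset.mem_toList.2 hσ)), hs.2⟩
  choose M hM s hs hφ using this
  let 𝒰 : Ultrafilter (Finset T) := .of Filter.atTop
  refine absurd (h (.ultraproduct 𝒰 M) (LStructure.isLStructure_ultraproduct hM)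
    (fun σ hσ t => ?_) fun n => LStructure.toUltraproduct 𝒰 M fun F => s F n) ?_
  · choose f hf using fun n => LStructure.exists_toUltraproduct_eq (t n)
    rw [← funext hf, LStructure.sat_ultraproduct hM]
    have hσF : ∀ᶠ F in (𝒰 : Filter (Finset T)), {⟨σ, hσ⟩} ⊆ F :=
      (Filter.eventually_ge_atTop _).filter_mono (Ultrafilter.of_le _)
    refine hσF.mono fun F hF => ?_
    rw [LStructure.sat_congr (hM F) σ (t := s F) (by simp [hsent σ hσ])]
    exact hs F ⟨σ, hσ⟩ (Finset.singleton_subset_iff.1 hF)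
  · rw [LStructure.sat_ultraproduct hM]
    simp [hφ, 𝒰.neBot.ne]
end
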